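/- If L ∘ T₀(t) is a compact operator for every t > 0, then ω_ess(R₀) = ω_ess(T₀). -/

import Mathlib

open Set Filter MeasureTheory
open scoped Topology

noncomputable section

structure MRSetting (X : Type*) [NormedAddCommGroup X] [NormedSpace ℂ X] [CompleteSpace X]
    (X₀ : Submodule ℂ X) where
  closed : IsClosed (X₀ : Set X)
  T : ℝ → (X₀ →L[ℂ] X₀)
  S : ℝ → (X →L[ℂ] X₀)
  T_zero : T 0 = 1
  T_add : ∀ t s : ℝ, 0 ≤ t → 0 ≤ s → T (t + s) = (T t).comp (T s)
  T_cont : ∀ x : X₀, ContinuousOn (fun t => T t x) (Ici 0)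
  S_zero : S 0 = 0
  S_cont : ∀ x : X, ContinuousOn (fun t => S t x) (Ici 0)
  TS : ∀ t s : ℝ, 0 ≤ t → 0 ≤ s → ∀ x : X, T t (S s x) = S (t + s) x - S t x
  δ : ℝ → ℝ
  δ_nonneg : ∀ t : ℝ, 0 ≤ t → 0 ≤ δ t
  δ_mono : MonotoneOn δ (Ici 0)
  δ_lim : Tendsto δ (𝓝[>] 0) (𝓝 0)
  SD : (ℝ → X) → ℝ → X₀
  SD_deriv : ∀ f : ℝ → X, ContinuousOn f (Ici 0) → ∀ t ∈ Ici (0:ℝ),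
    HasDerivWithinAt (fun τ : ℝ => ∫ s in (0:ℝ)..τ, S (τ - s) (f s)) (SD f t) (Ici 0) t
  SD_cont : ∀ f : ℝ → X, ContinuousOn f (Ici 0) → ContinuousOn (SD f) (Ici 0)
  SD_bound : ∀ f : ℝ → X, ContinuousOn f (Ici 0) → ∀ t ∈ Ici (0:ℝ),
    ‖SD f t‖ ≤ δ t * ⨆ s : Icc (0:ℝ) t, ‖f (s : ℝ)‖
  SDop : (ℝ → (X₀ →L[ℂ] X)) → ℝ → (X₀ →L[ℂ] X₀)
  SDop_apply : ∀ V : ℝ → (X₀ →L[ℂ] X), (∀ x : X₀, ContinuousOn (fun s => V s x) (Ici 0)) →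
    ∀ t : ℝ, ∀ x : X₀, SDop V t x = SD (fun s => V s x) t

variable {X : Type*} [NormedAddCommGroup X] [NormedSpace ℂ X] [CompleteSpace X]
  {X₀ : Submodule ℂ X}

/-- The perturbation operator `B(U) = S ⋄ (L ∘ U)`. -/
def MRSetting.Bop (M : MRSetting X X₀) (L : X₀ →L[ℂ] X) (U : ℝ → (X₀ →L[ℂ] X₀)) :
    ℝ → (X₀ →L[ℂ] X₀) :=
  M.SDop (fun s => L.comp (U s))


/-- The essential growth bound of an operator family `W`, defined through the operator-norm
distance from `W t` to the compact operators. -/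
def omegaEss (W : ℝ → (X₀ →L[ℂ] X₀)) : EReal :=
  sInf ((fun w : ℝ => (w : EReal)) ''
    {w : ℝ | ∃ C : ℝ, 0 ≤ C ∧ ∀ t : ℝ, 0 ≤ t →
      Metric.infDist (W t) {K : X₀ →L[ℂ] X₀ | IsCompactOperator ⇑K} ≤ C * Real.exp (w * t)})

/-- The operator induced on `ℓ^∞(X₀)` (bounded sequences in `X₀`) by coordinatewise
application of a bounded operator. -/
def seqOp (W : X₀ →L[ℂ] X₀) :
    BoundedContinuousFunction ℕ X₀ →L[ℂ] BoundedContinuousFunction ℕ X₀ :=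
  W.compLeftContinuousBounded ℕ

/-- The subspace `ℓ^∞_W(X₀)` of strong continuity of the extension of `W` to `ℓ^∞(X₀)`:
those bounded sequences `x` with `sup_n ‖W(t) xₙ − xₙ‖ → 0` as `t → 0⁺`. -/
def critSub (W : ℝ → (X₀ →L[ℂ] X₀)) : Submodule ℂ (BoundedContinuousFunction ℕ X₀) where
  carrier := {x | Tendsto (fun t : ℝ => seqOp (W t) x) (𝓝[>] 0) (𝓝 x)}
  add_mem' := by
    intro a b ha hb
    simp only [Set.mem_setOf_eq, map_add] at ha hb ⊢
    exact Tendsto.add ha hb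
  zero_mem' := by
    simp only [Set.mem_setOf_eq, map_zero]
    exact tendsto_const_nhds
  smul_mem' := by
    intro c x hx
    simp only [Set.mem_setOf_eq, _root_.map_smul] at hx ⊢
    exact Tendsto.const_smul hx c

/-- The critical growth bound of an operator family `W`: the growth bound of the operators
induced by `W` on the quotient `ℓ^∞(X₀)/ℓ^∞_W(X₀)`, expressed via the quotient norm
`‖[x]‖ = infDist x ℓ^∞_W(X₀)`. -/
def omegaCrit (W : ℝ → (X₀ →L[ℂ] X₀)) : EReal :=
  sInf ((fun w : ℝ => (w : EReal)) ''
    {w : ℝ | ∃ C : ℝ, 0 ≤ C ∧ ∀ t : ℝ, 0 ≤ t → ∀ x : BoundedContinuousFunction ℕ X₀,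
      Metric.infDist (seqOp (W t) x) (critSub W : Set (BoundedContinuousFunction ℕ X₀)) ≤
        C * Real.exp (w * t) *
          Metric.infDist x (critSub W : Set (BoundedContinuousFunction ℕ X₀))})



lemma aux_dual_bound (μ : Measure ℝ) [IsFiniteMeasure μ] [μ.WeaklyRegular] {p : ℝ} (hp : 1 ≤ p)
    (g : ℝ → ℂ) (hg : Measurable g) (B : ℝ) (hB : ∀ᵐ x ∂μ, ‖g x‖ ≤ B)
    (c : ℝ) (hc : 0 ≤ c)
    (H : ∀ ψ : BoundedContinuousFunction ℝ ℂ, ‖∫ x, ψ x * g x ∂μ‖ ≤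
      c * (eLpNorm (ψ : ℝ → ℂ) (ENNReal.ofReal p) μ).toReal) (E : Set ℝ) (hE : MeasurableSet E) :
    eLpNorm (E.indicator g) 1 μ ≤ ENNReal.ofReal (c * (μ E).toReal ^ (1 / p)) := by
  have hP1 : (1 : ENNReal) ≤ ENNReal.ofReal p := by
    rw [← ENNReal.ofReal_one]; exact ENNReal.ofReal_le_ofReal hp
  have hPtop : ENNReal.ofReal p ≠ ⊤ := ENNReal.ofReal_ne_top
  have hP0 : ENNReal.ofReal p ≠ 0 := (lt_of_lt_of_le zero_lt_one hP1).ne'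
  set P := ENNReal.ofReal p with hP
  have hPr : P.toReal = p := ENNReal.toReal_ofReal (by linarith)
  -- the sign function
  let ψ0 : ℝ → ℂ := E.indicator (fun x => (starRingEnd ℂ) (g x) / (‖g x‖ : ℂ))
  have hψ0m : Measurable ψ0 := by
    apply Measurable.indicator _ hE
    apply Measurable.div
    · exact (Complex.continuous_conj.measurable).comp hg
    · exact Complex.measurable_ofReal.comp hg.norm
  have hψ0b : ∀ x, ‖ψ0 x‖ ≤ (E.indicator (fun _ => (1:ℝ)) x) := by
    intro x
    by_cases hx : x ∈ E
    · simp only [ψ0, indicator_of_mem hx, norm_div, RCLike.norm_conj, Complex.norm_real, norm_norm]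
      exact div_self_le_one _
    · simp [ψ0, indicator_of_notMem hx]
  have hψ0b1 : ∀ x, ‖ψ0 x‖ ≤ 1 := fun x => (hψ0b x).trans (by
    by_cases hx : x ∈ E <;> simp [hx])
  have hψ0L : MemLp ψ0 P μ := MemLp.of_bound hψ0m.aestronglyMeasurable 1 (ae_of_all _ hψ0b1)
  have hψ0g : ∀ x, ψ0 x * g x = ((E.indicator (fun x => ‖g x‖) x : ℝ) : ℂ) := by
    intro x
    by_cases hx : x ∈ E
    · simp only [ψ0, indicator_of_mem hx]
      by_cases h0 : g x = 0
      · simp [h0]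
      · have : (‖g x‖ : ℂ) ≠ 0 := by simpa using h0
        field_simp
        rw [mul_comm, Complex.mul_conj, Complex.normSq_eq_norm_sq]; push_cast; ring
    · simp [ψ0, indicator_of_notMem hx]
  have hgL : MemLp g ⊤ μ := memLp_top_of_bound hg.aestronglyMeasurable B hB
  have hgI : Integrable g μ := (hgL.mono_exponent le_top : MemLp g 1 μ).integrable le_rfl
  have hB' : ∀ ψ : ℝ → ℂ, Integrable ψ μ → ‖∫ x, ψ x * g x ∂μ‖ ≤ |B| * ∫ x, ‖ψ x‖ ∂μ := by
    intro ψ hψ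
    rw [← integral_const_mul]
    apply norm_integral_le_of_norm_le (hψ.norm.const_mul _)
    filter_upwards [hB] with x hx
    rw [norm_mul, mul_comm]
    exact mul_le_mul_of_nonneg_right (hx.trans (le_abs_self B)) (norm_nonneg _)
  have hint : ∀ ψ : ℝ → ℂ, MemLp ψ P μ → Integrable (fun x => ψ x * g x) μ := by
    intro ψ hψ
    have := (hψ.integrable hP1)
    exact this.mul_bdd (c := B) hg.aestronglyMeasurable hB
  have key : ∫ x, E.indicator (fun x => ‖g x‖) x ∂μ ≤ c * (eLpNorm ψ0 P μ).toReal := by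
    have h1 : ∫ x, E.indicator (fun x => ‖g x‖) x ∂μ = ‖∫ x, ψ0 x * g x ∂μ‖ := by
      simp_rw [hψ0g]
      rw [integral_complex_ofReal, Complex.norm_real, Real.norm_of_nonneg]
      apply integral_nonneg
      intro x
      exact indicator_nonneg (fun _ _ => norm_nonneg _) _
    rw [h1]
    set D : ℝ := (μ univ ^ (1 / (1:ENNReal).toReal - 1 / P.toReal)).toReal with hD
    have hDfin : μ univ ^ (1 / (1:ENNReal).toReal - 1 / P.toReal) ≠ ⊤ := by
      apply ENNReal.rpow_ne_top_of_nonneg _ (measure_ne_top _ _)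
      rw [hPr]; simp only [ENNReal.toReal_one]
      have : 1 / p ≤ 1 := by rw [div_le_one (by linarith)]; exact hp
      linarith
    have hest : ∀ ε : ℝ, 0 < ε → ‖∫ x, ψ0 x * g x ∂μ‖ ≤
        c * (eLpNorm ψ0 P μ).toReal + (c + |B| * D) * ε := by
      intro ε hε
      obtain ⟨ψ, hψ, hψL⟩ := hψ0L.exists_boundedContinuous_eLpNorm_sub_le hPtop
        (ε := ENNReal.ofReal ε) (by simpa using hε)
      have hdL : MemLp (ψ0 - (ψ : ℝ → ℂ)) P μ := hψ0L.sub hψL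
      have hdI := hdL.integrable hP1
      have e1 : ∫ x, ψ0 x * g x ∂μ = ∫ x, ψ x * g x ∂μ + ∫ x, (ψ0 - (ψ : ℝ → ℂ)) x * g x ∂μ := by
        rw [← integral_add (hint _ hψL) (hint _ hdL)]
        congr 1; ext x; simp only [Pi.sub_apply]; ring
      have e2 : (eLpNorm (ψ : ℝ → ℂ) P μ).toReal ≤ (eLpNorm ψ0 P μ).toReal + ε := by
        have h2 : eLpNorm (ψ : ℝ → ℂ) P μ ≤ eLpNorm ψ0 P μ + ENNReal.ofReal ε := by
          have h3 : (ψ : ℝ → ℂ) = ψ0 - (ψ0 - (ψ : ℝ → ℂ)) := by simp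
          calc eLpNorm (ψ : ℝ → ℂ) P μ = eLpNorm (ψ0 - (ψ0 - (ψ : ℝ → ℂ))) P μ := by rw [← h3]
            _ ≤ eLpNorm ψ0 P μ + eLpNorm (ψ0 - (ψ : ℝ → ℂ)) P μ :=
              eLpNorm_sub_le hψ0L.1 hdL.1 hP1
            _ ≤ _ := by gcongr
        have h4 := ENNReal.toReal_mono (by
          exact ENNReal.add_ne_top.2 ⟨hψ0L.2.ne, ENNReal.ofReal_ne_top⟩) h2
        rwa [ENNReal.toReal_add hψ0L.2.ne ENNReal.ofReal_ne_top, ENNReal.toReal_ofReal hε.le] at h4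
      have e3 : ∫ x, ‖(ψ0 - (ψ : ℝ → ℂ)) x‖ ∂μ ≤ D * ε := by
        have h5 : ∫ x, ‖(ψ0 - (ψ : ℝ → ℂ)) x‖ ∂μ = (eLpNorm (ψ0 - (ψ : ℝ → ℂ)) 1 μ).toReal := by
          rw [eLpNorm_one_eq_lintegral_enorm, integral_norm_eq_lintegral_enorm hdI.1]
        rw [h5]
        have h6 := eLpNorm_le_eLpNorm_mul_rpow_measure_univ hP1 hdL.1
        have h7 : eLpNorm (ψ0 - (ψ : ℝ → ℂ)) 1 μ ≤
          ENNReal.ofReal ε * μ univ ^ (1 / (1:ENNReal).toReal - 1 / P.toReal) :=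
          h6.trans (by gcongr)
        have h8 := ENNReal.toReal_mono (ENNReal.mul_ne_top ENNReal.ofReal_ne_top hDfin) h7
        rw [ENNReal.toReal_mul, ENNReal.toReal_ofReal hε.le] at h8
        rw [hD]; linarith [h8]
      calc ‖∫ x, ψ0 x * g x ∂μ‖ ≤ ‖∫ x, ψ x * g x ∂μ‖ + ‖∫ x, (ψ0 - (ψ : ℝ → ℂ)) x * g x ∂μ‖ := by
            rw [e1]; exact norm_add_le _ _
        _ ≤ c * ((eLpNorm ψ0 P μ).toReal + ε) + |B| * (D * ε) := by
            apply add_le_add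
            · exact (H ψ).trans (by gcongr)
            · exact (hB' _ hdI).trans (by gcongr)
        _ = _ := by ring
    apply le_of_forall_pos_le_add
    intro ε hε
    have hpos : 0 < c + |B| * D + 1 := by positivity
    have := hest (ε / (c + |B| * D + 1)) (by positivity)
    refine this.trans ?_
    gcongr
    rw [mul_div_assoc', div_le_iff₀ hpos]
    nlinarith
  have hψ0n : (eLpNorm ψ0 P μ).toReal ≤ (μ E).toReal ^ (1 / p) := by
    have h1 : eLpNorm ψ0 P μ ≤ eLpNorm (E.indicator (fun _ => (1:ℝ))) P μ := by
      apply eLpNorm_mono_real hψ0b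
    rw [eLpNorm_indicator_const hE hP0 hPtop, hPr] at h1
    simp only [enorm_one, one_mul] at h1
    have h2 := ENNReal.toReal_mono (ENNReal.rpow_ne_top_of_nonneg (by positivity)
      (measure_ne_top _ _)) h1
    rwa [← ENNReal.toReal_rpow] at h2
  have hEg : Integrable (E.indicator g) μ := hgI.indicator hE
  rw [eLpNorm_one_eq_lintegral_enorm, ← ofReal_integral_norm_eq_lintegral_enorm hEg]
  apply ENNReal.ofReal_le_ofReal
  have : ∫ x, ‖E.indicator g x‖ ∂μ = ∫ x, E.indicator (fun x => ‖g x‖) x ∂μ := by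
    congr 1; ext x; exact norm_indicator_eq_indicator_norm _ _
  rw [this]
  exact key.trans (by gcongr)

/-- the difference quotients -/
def dq (v : ℝ → ℂ) (n : ℕ) (u : ℝ) : ℂ := (((n:ℝ) + 1 : ℝ) : ℂ) * (v (u + 1 / ((n:ℝ) + 1)) - v u)

lemma dq_cont (v : ℝ → ℂ) (hv : Continuous v) (n : ℕ) : Continuous (dq v n) := by
  unfold dq; fun_prop

lemma dq_tendsto (v : ℝ → ℂ) (v' : ℂ) (x : ℝ) (h : HasDerivAt v v' x) :
    Tendsto (fun n => dq v n x) atTop (𝓝 v') := by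
  have h1 := h.tendsto_slope_zero
  have h2 : Tendsto (fun n : ℕ => 1 / ((n:ℝ) + 1)) atTop (𝓝[≠] 0) := by
    rw [tendsto_nhdsWithin_iff]
    refine ⟨tendsto_one_div_add_atTop_nhds_zero_nat, Eventually.of_forall fun n => ?_⟩
    have : (0:ℝ) < 1 / ((n:ℝ) + 1) := by positivity
    exact this.ne'
  have h3 := h1.comp h2
  refine h3.congr fun n => ?_
  simp [dq, Function.comp]

lemma dq_integral (v : ℝ → ℂ) (hv : Continuous v) (a b : ℝ) :
    Tendsto (fun n => ∫ u in a..b, dq v n u) atTop (𝓝 (v b - v a)) := by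
  let V : ℝ → ℂ := fun x => ∫ u in (0:ℝ)..x, v u
  have hV : ∀ x, HasDerivAt V (v x) x := fun x => hv.deriv_integral v 0 x ▸
    (intervalIntegral.integral_hasDerivAt_right (hv.intervalIntegrable _ _)
      (hv.stronglyMeasurableAtFilter _ _) hv.continuousAt).differentiableAt.hasDerivAt
  have h := (dq_tendsto V _ b (hV b)).sub (dq_tendsto V _ a (hV a))
  refine h.congr fun n => ?_
  have hi : ∀ x y, IntervalIntegrable v volume x y := fun x y => hv.intervalIntegrable _ _
  have hs : ∀ x y, ∫ u in x..y, v u = V y - V x := fun x y => by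
    simp only [V]; rw [intervalIntegral.integral_interval_sub_left (hi _ _) (hi _ _)]
  unfold dq
  rw [intervalIntegral.integral_const_mul, intervalIntegral.integral_sub
    (by apply Continuous.intervalIntegrable; fun_prop) (hi _ _),
    intervalIntegral.integral_comp_add_right (fun u => v u), hs, hs]
  ring

lemma dq_cauchy (v : ℝ → ℂ) (hv : Continuous v) (τ : ℝ) (hτ : 0 < τ) {p : ℝ} (hp : 1 ≤ p)
    (c : ℝ) (hc : 0 ≤ c)
    (H : ∀ n : ℕ, ∀ ψ : BoundedContinuousFunction ℝ ℂ, ‖∫ u in (0:ℝ)..τ, ψ u * dq v n u‖ ≤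
      c * (∫ u in (0:ℝ)..τ, ‖ψ u‖ ^ p) ^ (1 / p)) :
    ∀ ε > 0, ∃ n0, ∀ m ≥ n0, ∀ n ≥ n0, ∫ u in (0:ℝ)..τ, ‖dq v m u - dq v n u‖ ≤ ε := by
  set μ : Measure ℝ := volume.restrict (Ioc 0 τ) with hμ
  have hp0 : 0 < p := by linarith
  have : IsFiniteMeasure μ := ⟨by simp [hμ]⟩
  have hbound : ∀ n, ∃ B, ∀ᵐ x ∂μ, ‖dq v n x‖ ≤ B := by
    intro n
    obtain ⟨B, hB⟩ := (isCompact_Icc (a := (0:ℝ)) (b := τ)).exists_bound_of_continuousOn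
      (dq_cont v hv n).continuousOn
    refine ⟨B, ?_⟩
    filter_upwards [ae_restrict_mem measurableSet_Ioc] with x hx
    exact hB x ⟨hx.1.le, hx.2⟩
  have hE : ∀ n, ∀ E : Set ℝ, MeasurableSet E → eLpNorm (E.indicator (dq v n)) 1 μ ≤
      ENNReal.ofReal (c * (μ E).toReal ^ (1 / p)) := by
    intro n E hEm
    obtain ⟨B, hB⟩ := hbound n
    refine aux_dual_bound μ hp _ (dq_cont v hv n).measurable B hB c hc ?_ E hEm
    intro ψ
    have hψ : MemLp (ψ : ℝ → ℂ) (ENNReal.ofReal p) μ :=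
      MemLp.of_bound ψ.continuous.aestronglyMeasurable ‖ψ‖ (ae_of_all _ ψ.norm_coe_le_norm)
    have h1 := H n ψ
    rw [intervalIntegral.integral_of_le hτ.le, intervalIntegral.integral_of_le hτ.le] at h1
    rw [hψ.eLpNorm_eq_integral_rpow_norm (by simpa using hp0) ENNReal.ofReal_ne_top,
      ENNReal.toReal_ofReal hp0.le, ENNReal.toReal_ofReal (by positivity)]
    simpa [one_div] using h1
  have hμu : (μ univ).toReal = τ := by simp [hμ, hτ.le]
  have hL1 : ∀ n, eLpNorm (dq v n) 1 μ ≤ ENNReal.ofReal (c * τ ^ (1 / p)) := by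
    intro n
    have := hE n univ MeasurableSet.univ
    rwa [indicator_univ, hμu] at this
  have hint : ∀ n, IntegrableOn (dq v n) (Ioc 0 τ) volume := fun n =>
    ((dq_cont v hv n).integrableOn_Icc).mono_set Ioc_subset_Icc_self
  have hL1' : ∀ n, ∫ u in (0:ℝ)..τ, ‖dq v n u‖ ≤ c * τ ^ (1 / p) := by
    intro n
    have h1 := hL1 n
    rw [eLpNorm_one_eq_lintegral_enorm, ← ofReal_integral_norm_eq_lintegral_enorm (hint n),
      ENNReal.ofReal_le_ofReal_iff (by positivity)] at h1
    rwa [intervalIntegral.integral_of_le hτ.le]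
  have hBV : BoundedVariationOn v (uIcc 0 τ) := by
    have : eVariationOn v (uIcc 0 τ) ≤ ENNReal.ofReal (c * τ ^ (1 / p)) := by
      rw [uIcc_of_le hτ.le]
      apply iSup_le
      rintro ⟨N, ⟨u, hu, hmem⟩⟩
      simp only
      have h1 : ∑ i ∈ Finset.range N, edist (v (u (i+1))) (v (u i)) =
          ENNReal.ofReal (∑ i ∈ Finset.range N, ‖v (u (i+1)) - v (u i)‖) := by
        rw [ENNReal.ofReal_sum_of_nonneg (fun _ _ => norm_nonneg _)]
        refine Finset.sum_congr rfl fun i _ => ?_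
        rw [edist_dist, dist_eq_norm]
      rw [h1]
      apply ENNReal.ofReal_le_ofReal
      have ht : Tendsto (fun n => ∑ i ∈ Finset.range N, ‖∫ x in (u i)..(u (i+1)), dq v n x‖) atTop
          (𝓝 (∑ i ∈ Finset.range N, ‖v (u (i+1)) - v (u i)‖)) :=
        tendsto_finsetSum _ fun i _ => (dq_integral v hv _ _).norm
      refine le_of_tendsto' ht fun n => ?_
      have hii : ∀ x y, IntervalIntegrable (fun x => ‖dq v n x‖) volume x y := fun x y =>
        (dq_cont v hv n).norm.intervalIntegrable _ _
      calc ∑ i ∈ Finset.range N, ‖∫ x in (u i)..(u (i+1)), dq v n x‖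
          ≤ ∑ i ∈ Finset.range N, ∫ x in (u i)..(u (i+1)), ‖dq v n x‖ :=
            Finset.sum_le_sum fun i _ =>
              intervalIntegral.norm_integral_le_integral_norm (hu (Nat.le_succ i))
        _ = ∫ x in (u 0)..(u N), ‖dq v n x‖ :=
            intervalIntegral.sum_integral_adjacent_intervals fun k _ => hii _ _
        _ ≤ ∫ x in (0:ℝ)..τ, ‖dq v n x‖ :=
            intervalIntegral.integral_mono_interval (hmem 0).1 (hu (Nat.zero_le N)) (hmem N).2
              (ae_of_all _ fun x => norm_nonneg _) (hii _ _)
        _ ≤ _ := hL1' n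
    exact ne_top_of_le_ne_top ENNReal.ofReal_ne_top this
  have hae : ∀ᵐ x ∂μ, Tendsto (fun n => dq v n x) atTop (𝓝 (deriv v x)) := by
    have h1 := hBV.ae_differentiableAt_of_mem_uIcc
    rw [hμ, ae_restrict_iff' measurableSet_Ioc]
    filter_upwards [h1] with x hx hx'
    apply dq_tendsto
    exact (hx (by rw [uIcc_of_le hτ.le]; exact ⟨hx'.1.le, hx'.2⟩)).hasDerivAt
  have hmeas : ∀ n, AEStronglyMeasurable (dq v n) μ := fun n =>
    (dq_cont v hv n).aestronglyMeasurable
  have hder : MemLp (deriv v) 1 μ := by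
    refine ⟨(measurable_deriv v).aestronglyMeasurable, ?_⟩
    refine lt_of_le_of_lt (Lp.eLpNorm_lim_le_liminf_eLpNorm hmeas _ hae) ?_
    refine lt_of_le_of_lt (liminf_le_of_frequently_le' (Frequently.of_forall hL1)) ?_
    exact ENNReal.ofReal_lt_top
  have hui : UnifIntegrable (dq v) 1 μ := by
    intro ε hε
    refine ⟨(ε / (c + 1)) ^ p, by positivity, fun n s hs hμs => ?_⟩
    refine (hE n s hs).trans (ENNReal.ofReal_le_ofReal ?_)
    have h1 : (μ s).toReal ≤ (ε / (c + 1)) ^ p :=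
      ENNReal.toReal_le_of_le_ofReal (by positivity) hμs
    calc c * (μ s).toReal ^ (1 / p) ≤ c * ((ε / (c + 1)) ^ p) ^ (1 / p) := by gcongr
      _ = c * (ε / (c + 1)) := by
        rw [← Real.rpow_mul (by positivity), mul_one_div_cancel hp0.ne', Real.rpow_one]
      _ ≤ ε := by
        rw [mul_div_assoc', div_le_iff₀ (by linarith)]; nlinarith
  have hconv := tendsto_Lp_finite_of_tendsto_ae le_rfl ENNReal.one_ne_top hmeas hder hui hae
  intro ε hε
  have hev := (tendsto_order.1 hconv).2 (ENNReal.ofReal (ε / 2)) (by simpa using hε)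
  obtain ⟨n0, hn0⟩ := eventually_atTop.1 hev
  refine ⟨n0, fun m hm n hn => ?_⟩
  have hdi : Integrable (dq v m - dq v n) μ := (hint m).sub (hint n)
  rw [intervalIntegral.integral_of_le hτ.le]
  have h2 : eLpNorm (dq v m - dq v n) 1 μ ≤ ENNReal.ofReal ε := by
    have h3 : dq v m - dq v n = (dq v m - deriv v) - (dq v n - deriv v) := by abel
    rw [h3]
    calc _ ≤ eLpNorm (dq v m - deriv v) 1 μ + eLpNorm (dq v n - deriv v) 1 μ :=
          eLpNorm_sub_le ((hmeas m).sub hder.1) ((hmeas n).sub hder.1) le_rfl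
      _ ≤ ENNReal.ofReal (ε / 2) + ENNReal.ofReal (ε / 2) :=
          add_le_add (hn0 m hm).le (hn0 n hn).le
      _ = ENNReal.ofReal ε := by
          rw [← ENNReal.ofReal_add (by positivity) (by positivity)]; congr 1; ring
  rw [eLpNorm_one_eq_lintegral_enorm, ← ofReal_integral_norm_eq_lintegral_enorm hdi,
      ENNReal.ofReal_le_ofReal_iff hε.le] at h2
  exact h2

section generic
variable {E F : Type*} [NormedAddCommGroup E] [NormedSpace ℂ E] [NormedAddCommGroup F]
  [NormedSpace ℂ F]

lemma locbdd [CompleteSpace E] (V : ℝ → E →L[ℂ] F)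
    (hV : ∀ x, ContinuousOn (fun t => V t x) (Ici 0)) (τ : ℝ) :
    ∃ C, 0 < C ∧ ∀ t ∈ Icc (0:ℝ) τ, ‖V t‖ ≤ C := by
  obtain ⟨C, hC⟩ := banach_steinhaus (g := fun t : Icc (0:ℝ) τ => V t) (by
    intro x
    obtain ⟨C, hC⟩ := (isCompact_Icc (a := (0:ℝ)) (b := τ)).exists_bound_of_continuousOn
      ((hV x).mono Icc_subset_Ici_self)
    exact ⟨C, fun t => hC t t.2⟩)
  refine ⟨max C 1, by positivity, fun t ht => (hC ⟨t, ht⟩).trans (le_max_left _ _)⟩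

lemma strong_comp [CompleteSpace E] (V : ℝ → E →L[ℂ] F)
    (hV : ∀ x, ContinuousOn (fun t => V t x) (Ici 0)) (τ : ℝ) (s : Set ℝ) (a : ℝ → ℝ)
    (ha : ContinuousOn a s) (has : MapsTo a s (Icc 0 τ)) (g : ℝ → E) (hg : ContinuousOn g s) :
    ContinuousOn (fun r => V (a r) (g r)) s := by
  obtain ⟨C, hC0, hC⟩ := locbdd V hV τ
  intro r0 hr0
  have h1 : Tendsto (fun r => V (a r) (g r0)) (𝓝[s] r0) (𝓝 (V (a r0) (g r0))) := by
    have := ((hV (g r0)).comp ha (fun r hr => (has hr).1)) r0 hr0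
    exact this
  have h2 : Tendsto (fun r => V (a r) (g r - g r0)) (𝓝[s] r0) (𝓝 0) := by
    have h3 : Tendsto (fun r => C * ‖g r - g r0‖) (𝓝[s] r0) (𝓝 0) := by
      have := ((hg r0 hr0).sub_const (g r0)).norm.const_mul C
      simpa using this
    refine squeeze_zero_norm' ?_ h3
    filter_upwards [self_mem_nhdsWithin] with r hr
    exact (V (a r)).le_of_opNorm_le (hC _ (has hr)) _
  have h4 := h2.add h1
  rw [zero_add] at h4
  refine h4.congr fun r => ?_
  rw [← map_add]; simp
end generic

namespace MRSetting

variable (M : MRSetting X X₀)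
include M

lemma complete : CompleteSpace X₀ := M.closed.completeSpace_coe

lemma δ_zero : M.δ 0 = 0 := by
  apply le_antisymm _ (M.δ_nonneg 0 le_rfl)
  refine ge_of_tendsto M.δ_lim ?_
  filter_upwards [self_mem_nhdsWithin] with t ht
  exact M.δ_mono self_mem_Ici (mem_Ici.2 (le_of_lt ht)) (le_of_lt ht)

lemma SD_norm_le (f : ℝ → X) (hf : ContinuousOn f (Ici 0)) (t : ℝ) (ht : 0 ≤ t) (c : ℝ)
    (h : ∀ s ∈ Icc (0:ℝ) t, ‖f s‖ ≤ c) : ‖M.SD f t‖ ≤ M.δ t * c := by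
  refine (M.SD_bound f hf t ht).trans (mul_le_mul_of_nonneg_left ?_ (M.δ_nonneg t ht))
  have : Nonempty (Icc (0:ℝ) t) := ⟨⟨0, le_rfl, ht⟩⟩
  exact ciSup_le fun s => h s s.2

lemma SD_zero (f : ℝ → X) (hf : ContinuousOn f (Ici 0)) : M.SD f 0 = 0 := by
  have := M.SD_bound f hf 0 self_mem_Ici
  rw [M.δ_zero, zero_mul] at this
  simpa using this

lemma S_int (f : ℝ → X) (hf : ContinuousOn f (Ici 0)) (t : ℝ) (ht : 0 ≤ t) :
    IntervalIntegrable (fun s => M.S (t - s) (f s)) volume 0 t := by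
  apply ContinuousOn.intervalIntegrable
  rw [uIcc_of_le ht]
  refine strong_comp M.S M.S_cont t _ _ (by fun_prop) ?_ _ (hf.mono Icc_subset_Ici_self)
  intro r hr
  exact ⟨by linarith [hr.2], by linarith [hr.1]⟩

lemma TS_int (f : ℝ → X) (hf : ContinuousOn f (Ici 0)) (t h a b : ℝ) (ha : 0 ≤ a) (hab : a ≤ b)
    (hb : b ≤ t) :
    IntervalIntegrable (fun s => M.T (t - s) (M.S h (f s))) volume a b := by
  have := M.complete
  apply ContinuousOn.intervalIntegrable
  rw [uIcc_of_le hab]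
  refine strong_comp M.T M.T_cont t _ _ (by fun_prop) ?_ _
    ((M.S h).continuous.comp_continuousOn (hf.mono ?_))
  · intro r hr
    exact ⟨by linarith [hr.2], by linarith [hr.1]⟩
  · intro r hr; exact ha.trans hr.1

lemma SD_add (f g : ℝ → X) (hf : ContinuousOn f (Ici 0)) (hg : ContinuousOn g (Ici 0)) (t : ℝ)
    (ht : 0 ≤ t) : M.SD (fun s => f s + g s) t = M.SD f t + M.SD g t := by
  have h1 := M.SD_deriv _ (hf.add hg) t ht
  have h2 := (M.SD_deriv _ hf t ht).add (M.SD_deriv _ hg t ht)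
  refine UniqueDiffWithinAt.eq_deriv _ (uniqueDiffOn_Ici 0 t ht) h1 (h2.congr_of_mem ?_ ht)
  intro τ hτ
  simp only [Pi.add_apply, map_add]
  rw [intervalIntegral.integral_add (M.S_int f hf τ hτ) (M.S_int g hg τ hτ)]

lemma SD_sub (f g : ℝ → X) (hf : ContinuousOn f (Ici 0)) (hg : ContinuousOn g (Ici 0)) (t : ℝ)
    (ht : 0 ≤ t) : M.SD (fun s => f s - g s) t = M.SD f t - M.SD g t := by
  have := M.SD_add (fun s => f s - g s) g (hf.sub hg) hg t ht
  simp only [sub_add_cancel] at this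
  rw [this]; simp

lemma SD_zero_fun (t : ℝ) (ht : 0 ≤ t) : M.SD (fun _ => 0) t = 0 := by
  have := M.SD_norm_le (fun _ => 0) continuousOn_const t ht 0 (by simp)
  simpa using this

lemma SD_sum {ι : Type*} (s : Finset ι) (f : ι → ℝ → X) (hf : ∀ i ∈ s, ContinuousOn (f i) (Ici 0))
    (t : ℝ) (ht : 0 ≤ t) : M.SD (fun r => ∑ i ∈ s, f i r) t = ∑ i ∈ s, M.SD (f i) t := by
  classical
  induction s using Finset.induction_on with
  | empty => simpa using M.SD_zero_fun t ht
  | insert a s ha ih =>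
    simp only [Finset.sum_insert ha]
    rw [M.SD_add _ _ (hf a (by simp)) (continuousOn_finsetSum _ fun i hi => hf i (by simp [hi])) t ht,
      ih fun i hi => hf i (by simp [hi])]

lemma SD_congr (f g : ℝ → X) (hf : ContinuousOn f (Ici 0)) (hg : ContinuousOn g (Ici 0)) (t : ℝ)
    (ht : 0 ≤ t) (h : ∀ s ∈ Icc (0:ℝ) t, f s = g s) : M.SD f t = M.SD g t := by
  have := M.SD_norm_le (fun s => f s - g s) (hf.sub hg) t ht 0 (by
    intro s hs; simp [h s hs])
  rw [M.SD_sub f g hf hg t ht] at this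
  simpa [sub_eq_zero] using this

/-- `∫₀ᵗ T(t-r) S(h) f(r) dr` -/
def J (f : ℝ → X) (t h : ℝ) : X₀ := ∫ r in (0:ℝ)..t, M.T (t - r) (M.S h (f r))

lemma shift_cont {f : ℝ → X} (hf : ContinuousOn f (Ici 0)) {t : ℝ} (ht : 0 ≤ t) :
    ContinuousOn (fun r => f (t + r)) (Ici 0) := by
  refine hf.comp (by fun_prop) ?_
  intro r hr
  exact add_nonneg ht hr

lemma J_eq (f : ℝ → X) (hf : ContinuousOn f (Ici 0)) (t h : ℝ) (ht : 0 ≤ t) (hh : 0 ≤ h) :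
    M.J f t h = (∫ s in (0:ℝ)..(t + h), M.S (t + h - s) (f s)) - (∫ s in (0:ℝ)..t, M.S (t - s) (f s))
      - ∫ s in (0:ℝ)..h, M.S (h - s) (f (t + s)) := by
  have hI := M.S_int f hf (t + h) (by positivity)
  have hI1 : IntervalIntegrable (fun s => M.S (t + h - s) (f s)) volume 0 t :=
    hI.mono_set (by rw [uIcc_of_le ht, uIcc_of_le (by positivity)]; exact Icc_subset_Icc_right (by linarith))
  have hI2 : IntervalIntegrable (fun s => M.S (t + h - s) (f s)) volume t (t + h) :=
    hI.mono_set (by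
      rw [uIcc_of_le (by linarith), uIcc_of_le (by positivity)]; exact Icc_subset_Icc_left ht)
  have e1 := intervalIntegral.integral_add_adjacent_intervals hI1 hI2
  have e2 : ∫ s in t..(t + h), M.S (t + h - s) (f s) = ∫ s in (0:ℝ)..h, M.S (h - s) (f (t + s)) := by
    have := intervalIntegral.integral_comp_add_left (a := 0) (b := h)
      (fun s => M.S (t + h - s) (f s)) t
    rw [add_zero] at this
    rw [← this]
    congr 1; ext s; congr 3; ring_nf
  have e3 : M.J f t h = (∫ s in (0:ℝ)..t, M.S (t + h - s) (f s)) - ∫ s in (0:ℝ)..t, M.S (t - s) (f s) := by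
    rw [← intervalIntegral.integral_sub hI1 (M.S_int f hf t ht)]
    unfold J
    apply intervalIntegral.integral_congr
    intro s hs
    rw [uIcc_of_le ht] at hs
    simp only
    rw [M.TS (t - s) h (by linarith [hs.2]) hh]
    congr 3; ring
  rw [e3, ← e1, e2]; abel

lemma J_deriv (f : ℝ → X) (hf : ContinuousOn f (Ici 0)) (t : ℝ) (ht : 0 ≤ t) (h : ℝ) (hh : 0 ≤ h) :
    HasDerivWithinAt (M.J f t) (M.SD f (t + h) - M.SD (fun r => f (t + r)) h) (Ici 0) h := by
  have h1 := M.SD_deriv f hf (t + h) (mem_Ici.2 (by positivity))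
  have h2 := M.SD_deriv _ (M.shift_cont hf ht) h hh
  have h3 : HasDerivWithinAt (fun u : ℝ => t + u) 1 (Ici 0) h :=
    ((hasDerivAt_id h).const_add t).hasDerivWithinAt
  have h4 := h1.scomp h h3 (by intro u hu; exact add_nonneg ht hu)
  rw [one_smul] at h4
  have h5 := (h4.sub_const (∫ s in (0:ℝ)..t, M.S (t - s) (f s))).sub h2
  exact h5.congr_of_mem (fun u hu => M.J_eq f hf t u ht hu) hh

lemma J_deriv_zero (f : ℝ → X) (hf : ContinuousOn f (Ici 0)) (t : ℝ) (ht : 0 ≤ t) :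
    HasDerivWithinAt (M.J f t) (M.SD f t) (Ici 0) 0 := by
  have := M.J_deriv f hf t ht 0 le_rfl
  rwa [add_zero, M.SD_zero _ (M.shift_cont hf ht), sub_zero] at this

lemma SD_shift (f : ℝ → X) (hf : ContinuousOn f (Ici 0)) (t s : ℝ) (ht : 0 ≤ t) (hs : 0 ≤ s) :
    M.SD f (t + s) = M.T s (M.SD f t) + M.SD (fun r => f (t + r)) s := by
  have := M.complete
  have h1 := M.J_deriv_zero f hf (t + s) (by positivity)
  have h2 := (M.T s).restrictScalars ℝ |>.hasFDerivAt.comp_hasDerivWithinAt 0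
    (M.J_deriv_zero f hf t ht)
  have h3 := h2.add (M.J_deriv_zero _ (M.shift_cont hf ht) s hs)
  refine UniqueDiffWithinAt.eq_deriv _ (uniqueDiffOn_Ici 0 0 self_mem_Ici) h1
    (h3.congr_of_mem ?_ self_mem_Ici)
  intro h hh
  simp only [Pi.add_apply, Function.comp, ContinuousLinearMap.coe_restrictScalars']
  unfold J
  rw [← ContinuousLinearMap.intervalIntegral_comp_comm _ (M.TS_int f hf t h 0 t le_rfl ht le_rfl)]
  rw [← intervalIntegral.integral_add_adjacent_intervals
    (M.TS_int f hf (t + s) h 0 t le_rfl ht (by linarith))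
    (M.TS_int f hf (t + s) h t (t + s) ht (by linarith) le_rfl)]
  congr 1
  · apply intervalIntegral.integral_congr
    intro r hr
    rw [uIcc_of_le ht] at hr
    simp only
    rw [show t + s - r = s + (t - r) by ring, M.T_add s (t - r) hs (by linarith [hr.2])]
    rfl
  · have := intervalIntegral.integral_comp_add_left (a := 0) (b := s)
      (fun r => M.T (t + s - r) (M.S h (f r))) t
    rw [add_zero] at this
    rw [← this]
    congr 1; ext r; congr 3; ring_nf

lemma J_avg (f : ℝ → X) (hf : ContinuousOn f (Ici 0)) (t : ℝ) (ht : 0 ≤ t) (h : ℝ) (hh : 0 ≤ h) :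
    M.J f t h = ∫ u in (0:ℝ)..h, M.T u (M.SD f t) := by
  have := M.complete
  have hc : ContinuousOn (M.J f t) (Icc 0 h) := fun u hu =>
    ((M.J_deriv f hf t ht u hu.1).continuousWithinAt).mono Icc_subset_Ici_self
  have h0 : M.J f t 0 = 0 := by simp [J, M.S_zero]
  have := intervalIntegral.integral_eq_sub_of_hasDeriv_right_of_le hh hc
    (f' := fun u => M.T u (M.SD f t)) (fun u hu => ?_) ?_
  · rw [this, h0, sub_zero]
  · have h1 := M.J_deriv f hf t ht u hu.1.le
    rw [M.SD_shift f hf t u ht hu.1.le, add_sub_cancel_right] at h1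
    exact h1.mono (fun y hy => hu.1.le.trans (le_of_lt hy))
  · apply ContinuousOn.intervalIntegrable
    rw [uIcc_of_le hh]
    exact (M.T_cont _).mono Icc_subset_Ici_self

lemma J_tendsto (f : ℝ → X) (hf : ContinuousOn f (Ici 0)) (t : ℝ) (ht : 0 ≤ t) :
    Tendsto (fun n : ℕ => ((n:ℝ) + 1) • M.J f t (1 / ((n:ℝ) + 1))) atTop (𝓝 (M.SD f t)) := by
  have h0 : M.J f t 0 = 0 := by simp [J, M.S_zero]
  have h1 := hasDerivWithinAt_iff_tendsto_slope.1 (M.J_deriv_zero f hf t ht)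
  have h2 : Tendsto (fun n : ℕ => 1 / ((n:ℝ) + 1)) atTop (𝓝[Ici 0 \ {0}] 0) := by
    rw [tendsto_nhdsWithin_iff]
    refine ⟨tendsto_one_div_add_atTop_nhds_zero_nat, Eventually.of_forall fun n => ?_⟩
    have : (0:ℝ) < 1 / ((n:ℝ) + 1) := by positivity
    exact ⟨this.le, this.ne'⟩
  refine (h1.comp h2).congr fun n => ?_
  simp [slope, h0, Function.comp]

end MRSetting

namespace MRSetting

variable (M : MRSetting X X₀)

lemma T_ii (x : X₀) (a b : ℝ) (ha : 0 ≤ a) (hb : 0 ≤ b) :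
    IntervalIntegrable (fun u => M.T u x) volume a b := by
  apply ContinuousOn.intervalIntegrable
  refine (M.T_cont x).mono fun u hu => ?_
  rcases le_total a b with h | h
  · rw [uIcc_of_le h] at hu; exact ha.trans hu.1
  · rw [uIcc_of_ge h] at hu; exact hb.trans hu.1

/-- averages of the semigroup -/
def A (n : ℕ) : X₀ →+ X₀ := AddMonoidHom.mk'
  (fun y => ((n:ℝ) + 1) • ∫ u in (0:ℝ)..(1 / ((n:ℝ) + 1)), M.T u y) (by
    intro x y
    simp only [map_add]
    rw [intervalIntegral.integral_add (M.T_ii x _ _ le_rfl (by positivity))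
      (M.T_ii y _ _ le_rfl (by positivity)), smul_add])

lemma A_apply (n : ℕ) (y : X₀) :
    M.A n y = ((n:ℝ) + 1) • ∫ u in (0:ℝ)..(1 / ((n:ℝ) + 1)), M.T u y := rfl

lemma A_norm (C : ℝ) (hC : ∀ t ∈ Icc (0:ℝ) 1, ‖M.T t‖ ≤ C) (n : ℕ) (y : X₀) :
    ‖M.A n y‖ ≤ C * ‖y‖ := by
  have hn : (0:ℝ) < (n:ℝ) + 1 := by positivity
  rw [A_apply, norm_smul, Real.norm_of_nonneg hn.le]
  have h1 : ‖∫ u in (0:ℝ)..(1 / ((n:ℝ) + 1)), M.T u y‖ ≤ C * ‖y‖ * |1 / ((n:ℝ) + 1) - 0| := by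
    apply intervalIntegral.norm_integral_le_of_norm_le_const
    intro u hu
    rw [uIoc_of_le (by positivity)] at hu
    refine (M.T u).le_of_opNorm_le (hC u ⟨hu.1.le, hu.2.trans ?_⟩) y
    rw [div_le_one hn]; linarith [Nat.cast_nonneg (α := ℝ) n]
  rw [sub_zero, abs_of_pos (by positivity)] at h1
  calc _ ≤ ((n:ℝ) + 1) * (C * ‖y‖ * (1 / ((n:ℝ) + 1))) := by gcongr
    _ = _ := by field_simp

lemma A_SD (f : ℝ → X) (hf : ContinuousOn f (Ici 0)) (t : ℝ) (ht : 0 ≤ t) (n : ℕ) :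
    M.A n (M.SD f t) = ((n:ℝ) + 1) • M.J f t (1 / ((n:ℝ) + 1)) := by
  rw [A_apply, M.J_avg f hf t ht _ (by positivity)]

lemma rep (z : X₀ →L[ℂ] ℂ) (k : X) (φ : ℝ → ℂ) (hφ : ContinuousOn φ (Ici 0)) (s : ℝ) (hs : 0 ≤ s)
    (n : ℕ) : z (M.A n (M.SD (fun r => φ r • k) s)) =
      ∫ u in (0:ℝ)..s, φ (s - u) * dq (fun u => z (M.S (max u 0) k)) n u := by
  have := M.complete
  have hf : ContinuousOn (fun r => φ r • k) (Ici 0) := hφ.smul continuousOn_const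
  rw [M.A_SD _ hf s hs]
  have e1 := intervalIntegral.integral_comp_sub_left (a := 0) (b := s)
    (fun u => φ (s - u) * dq (fun u => z (M.S (max u 0) k)) n u) s
  rw [sub_self, sub_zero] at e1
  rw [← e1]
  unfold J
  have e2 : ∀ c : ℝ, ∀ y : X₀, z (c • y) = (c : ℂ) * z y := by
    intro c y
    rw [← Complex.coe_smul, map_smul, smul_eq_mul]
  rw [e2, ← ContinuousLinearMap.intervalIntegral_comp_comm _
    (M.TS_int _ hf s _ 0 s le_rfl hs le_rfl), ← intervalIntegral.integral_const_mul]
  apply intervalIntegral.integral_congr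
  intro r hr
  rw [uIcc_of_le hs] at hr
  have hh : (0:ℝ) ≤ 1 / ((n:ℝ) + 1) := by positivity
  have hsr : 0 ≤ s - r := by linarith [hr.2]
  simp only [dq, map_smul]
  rw [M.TS _ _ hsr hh, max_eq_left hsr, max_eq_left (by linarith), map_sub, sub_sub_cancel,
    smul_eq_mul]
  ring

lemma phi_approx (z : X₀ →L[ℂ] ℂ) (k : X) (τ : ℝ) (hτ : 0 < τ)
    (p : ℝ) (hp : 1 ≤ p) (Mhat ωhat : ℝ) (hMhat : 0 ≤ Mhat)
    (hq : ∀ f : ℝ → X, ContinuousOn f (Ici 0) → ∀ t ∈ Ici (0:ℝ),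
      ‖M.SD f t‖ ≤ Mhat * (∫ s in (0:ℝ)..t, Real.exp (p * ωhat * (t - s)) * ‖f s‖ ^ p) ^ (1 / p)) :
    ∀ ε > 0, ∃ n0, ∀ n ≥ n0, ∀ φ : ℝ → ℂ, ContinuousOn φ (Ici 0) →
      (∀ r ∈ Icc (0:ℝ) τ, ‖φ r‖ ≤ 1) → ∀ s ∈ Icc (0:ℝ) τ,
      ‖z (M.SD (fun r => φ r • k) s - M.A n (M.SD (fun r => φ r • k) s))‖ ≤ ε := by
  have := M.complete
  have hp0 : 0 < p := by linarith
  obtain ⟨C, hC0, hC⟩ := locbdd M.T M.T_cont 1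
  set v : ℝ → ℂ := fun u => z (M.S (max u 0) k) with hv
  have hvc : Continuous v := by
    refine z.continuous.comp ?_
    exact (M.S_cont k).comp_continuous (by fun_prop) (fun u => mem_Ici.2 (le_max_right _ _))
  set c : ℝ := ‖z‖ * (C * (Mhat * (Real.exp (p * |ωhat| * τ) * ‖k‖ ^ p) ^ (1 / p))) with hcdef
  have hc : 0 ≤ c := by positivity
  have H : ∀ n : ℕ, ∀ ψ : BoundedContinuousFunction ℝ ℂ, ‖∫ u in (0:ℝ)..τ, ψ u * dq v n u‖ ≤
      c * (∫ u in (0:ℝ)..τ, ‖ψ u‖ ^ p) ^ (1 / p) := by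
    intro n ψ
    have hφ : ContinuousOn (fun r => ψ (τ - r)) (Ici 0) := by fun_prop
    have hf : ContinuousOn (fun r => ψ (τ - r) • k) (Ici 0) := by fun_prop
    have h1 := M.rep z k (fun r => ψ (τ - r)) hφ τ hτ.le n
    simp only [sub_sub_cancel] at h1
    rw [← h1]
    have hpc : ∀ g : ℝ → ℂ, Continuous g → Continuous (fun x => ‖g x‖ ^ p) := fun g hg =>
      hg.norm.rpow_const (fun x => Or.inr hp0.le)
    have h2 : ∫ s in (0:ℝ)..τ, Real.exp (p * ωhat * (τ - s)) * ‖ψ (τ - s) • k‖ ^ p ≤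
        (Real.exp (p * |ωhat| * τ) * ‖k‖ ^ p) * ∫ u in (0:ℝ)..τ, ‖ψ u‖ ^ p := by
      have e1 := intervalIntegral.integral_comp_sub_left (a := 0) (b := τ)
        (fun u => ‖ψ u‖ ^ p) τ
      rw [sub_self, sub_zero] at e1
      rw [← e1, ← intervalIntegral.integral_const_mul]
      apply intervalIntegral.integral_mono_on hτ.le
      · apply Continuous.intervalIntegrable
        exact (by fun_prop : Continuous fun s : ℝ => Real.exp (p * ωhat * (τ - s))).mul
          ((((by fun_prop : Continuous fun s : ℝ => ψ (τ - s) • k)).norm.rpow_const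
            (fun x => Or.inr hp0.le)))
      · apply Continuous.intervalIntegrable
        exact continuous_const.mul (hpc (fun s => ψ (τ - s)) (by fun_prop))
      · intro s hs
        rw [norm_smul, Real.mul_rpow (norm_nonneg _) (norm_nonneg _)]
        have : Real.exp (p * ωhat * (τ - s)) ≤ Real.exp (p * |ωhat| * τ) := by
          apply Real.exp_le_exp.2
          have h3 : ωhat * (τ - s) ≤ |ωhat| * τ :=
            mul_le_mul (le_abs_self _) (by linarith [hs.1]) (by linarith [hs.2]) (abs_nonneg _)
          rw [mul_assoc, mul_assoc]; gcongr
        calc _ ≤ Real.exp (p * |ωhat| * τ) * (‖ψ (τ - s)‖ ^ p * ‖k‖ ^ p) := by gcongr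
          _ = _ := by ring
    have hI0 : 0 ≤ ∫ u in (0:ℝ)..τ, ‖ψ u‖ ^ p :=
      intervalIntegral.integral_nonneg hτ.le fun u _ => by positivity
    calc _ ≤ ‖z‖ * ‖M.A n (M.SD (fun r => ψ (τ - r) • k) τ)‖ := z.le_opNorm _
      _ ≤ ‖z‖ * (C * ‖M.SD (fun r => ψ (τ - r) • k) τ‖) := by
        gcongr; exact M.A_norm C hC n _
      _ ≤ ‖z‖ * (C * (Mhat * ((Real.exp (p * |ωhat| * τ) * ‖k‖ ^ p) *
          ∫ u in (0:ℝ)..τ, ‖ψ u‖ ^ p) ^ (1 / p))) := by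
        gcongr
        refine (hq _ hf τ hτ.le).trans ?_
        gcongr
        exact intervalIntegral.integral_nonneg hτ.le fun u _ => by positivity
      _ = _ := by
        rw [Real.mul_rpow (by positivity) hI0, hcdef]; ring
  intro ε hε
  obtain ⟨n0, hn0⟩ := dq_cauchy v hvc τ hτ hp c hc H ε hε
  refine ⟨n0, fun n hn φ hφ hφ1 s hs => ?_⟩
  have hf : ContinuousOn (fun r => φ r • k) (Ici 0) := hφ.smul continuousOn_const
  have hlim : Tendsto (fun m => ‖z (M.A m (M.SD (fun r => φ r • k) s) -
      M.A n (M.SD (fun r => φ r • k) s))‖) atTop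
      (𝓝 ‖z (M.SD (fun r => φ r • k) s - M.A n (M.SD (fun r => φ r • k) s))‖) := by
    have h1 := M.J_tendsto _ hf s hs.1
    have h2 : Tendsto (fun m => M.A m (M.SD (fun r => φ r • k) s)) atTop
        (𝓝 (M.SD (fun r => φ r • k) s)) := by
      refine h1.congr fun m => ?_
      rw [M.A_SD _ hf s hs.1]
    exact ((z.continuous.tendsto _).comp (h2.sub_const _)).norm
  refine le_of_tendsto hlim ?_
  filter_upwards [eventually_ge_atTop n0] with m hm
  rw [map_sub, M.rep z k φ hφ s hs.1, M.rep z k φ hφ s hs.1]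
  have hφs : ContinuousOn (fun u => φ (s - u)) (uIcc 0 s) := by
    rw [uIcc_of_le hs.1]
    exact hφ.comp (by fun_prop) (fun u hu => by simpa using hu.2)
  have hii : ∀ m, IntervalIntegrable (fun u => φ (s - u) * dq v m u) volume 0 s := fun m =>
    (hφs.mul (dq_cont v hvc m).continuousOn).intervalIntegrable
  rw [← intervalIntegral.integral_sub (hii m) (hii n)]
  have hdc : Continuous (fun u => ‖dq v m u - dq v n u‖) :=
    ((dq_cont v hvc m).sub (dq_cont v hvc n)).norm
  calc _ ≤ ∫ u in (0:ℝ)..s, ‖dq v m u - dq v n u‖ := by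
        apply intervalIntegral.norm_integral_le_of_norm_le hs.1 _ (hdc.intervalIntegrable _ _)
        refine ae_of_all _ fun u hu => ?_
        rw [← mul_sub, norm_mul]
        have := hφ1 (s - u) ⟨by linarith [hu.2], by linarith [hu.1, hs.2]⟩
        exact mul_le_of_le_one_left (norm_nonneg _) this
    _ ≤ ∫ u in (0:ℝ)..τ, ‖dq v m u - dq v n u‖ :=
        intervalIntegral.integral_mono_interval le_rfl hs.1 hs.2
          (ae_of_all _ fun x => norm_nonneg _) (hdc.intervalIntegrable _ _)
    _ ≤ ε := hn0 m hm n hn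

lemma compact_approx (z : X₀ →L[ℂ] ℂ) (K : Set X) (hK : TotallyBounded K) (τ : ℝ) (hτ : 0 < τ)
    (p : ℝ) (hp : 1 ≤ p) (Mhat ωhat : ℝ) (hMhat : 0 ≤ Mhat)
    (hq : ∀ f : ℝ → X, ContinuousOn f (Ici 0) → ∀ t ∈ Ici (0:ℝ),
      ‖M.SD f t‖ ≤ Mhat * (∫ s in (0:ℝ)..t, Real.exp (p * ωhat * (t - s)) * ‖f s‖ ^ p) ^ (1 / p)) :
    ∀ ε > 0, ∃ n, ∀ f : ℝ → X, ContinuousOn f (Ici 0) →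
      (∀ r ∈ Icc (0:ℝ) τ, f r ∈ K) → ∀ s ∈ Icc (0:ℝ) τ,
      ‖z (M.SD f s - M.A n (M.SD f s))‖ ≤ ε := by
  have := M.complete
  intro ε hε
  obtain ⟨C, hC0, hC⟩ := locbdd M.T M.T_cont 1
  have hδ0 : 0 ≤ M.δ τ := M.δ_nonneg τ hτ.le
  set D : ℝ := ‖z‖ * ((1 + C) * M.δ τ) + 1 with hD
  have hD0 : 0 < D := by positivity
  set e : ℝ := ε / (2 * D) with he
  have he0 : 0 < e := by positivity
  obtain ⟨t, htf, ht⟩ := Metric.totallyBounded_iff.1 hK (e / 2) (by positivity)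
  lift t to Finset X using htf
  choose N hN using fun k : X => M.phi_approx z k τ hτ p hp Mhat ωhat hMhat hq
    (ε / (2 * ((t.card : ℝ) + 1))) (by positivity)
  refine ⟨t.sup N, fun f hf hfK s hs => ?_⟩
  set n := t.sup N with hn
  -- partition of unity
  let w : X → X → ℝ := fun k x => max 0 (e - ‖x - k‖)
  let W : X → ℝ := fun x => ∑ k ∈ t, w k x
  let φ : X → ℝ → ℂ := fun k r => ((w k (f r) / max (W (f r)) (e / 2) : ℝ) : ℂ)
  have hw0 : ∀ k x, 0 ≤ w k x := fun k x => le_max_left _ _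
  have hwc : ∀ k, Continuous (w k) := fun k => by simp only [w]; fun_prop
  have hWc : Continuous W := continuous_finsetSum _ fun k _ => hwc k
  have hmax : ∀ x, 0 < max (W x) (e / 2) := fun x => lt_of_lt_of_le (by positivity) (le_max_right _ _)
  have hφc : ∀ k, ContinuousOn (φ k) (Ici 0) := by
    intro k
    have h1 : Continuous fun x => ((w k x / max (W x) (e / 2) : ℝ) : ℂ) :=
      Complex.continuous_ofReal.comp ((hwc k).div (hWc.max continuous_const) fun x => (hmax x).ne')
    exact h1.comp_continuousOn hf
  have hφn : ∀ k r, ‖φ k r‖ = w k (f r) / max (W (f r)) (e / 2) := by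
    intro k r
    simp only [φ, Complex.norm_real]
    exact Real.norm_of_nonneg (div_nonneg (hw0 _ _) (hmax _).le)
  have hφ1 : ∀ k ∈ t, ∀ r, ‖φ k r‖ ≤ 1 := by
    intro k hk r
    rw [hφn, div_le_one (hmax _)]
    exact (Finset.single_le_sum (fun k _ => hw0 k (f r)) hk).trans (le_max_left _ _)
  let g : ℝ → X := fun r => ∑ k ∈ t, φ k r • k
  have hgc : ContinuousOn g (Ici 0) :=
    continuousOn_finsetSum _ fun k _ => (hφc k).smul continuousOn_const
  have herr : ∀ r ∈ Icc (0:ℝ) τ, ‖f r - g r‖ ≤ e := by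
    intro r hr
    have h1 : e / 2 ≤ W (f r) := by
      have := ht (hfK r hr)
      simp only [mem_iUnion, Metric.mem_ball, dist_eq_norm] at this
      obtain ⟨k, hk, hkr⟩ := this
      have h2 : e / 2 ≤ w k (f r) := le_trans (by linarith) (le_max_right _ _)
      exact h2.trans (Finset.single_le_sum (fun k _ => hw0 k (f r)) hk)
    have hW0 : 0 < W (f r) := lt_of_lt_of_le (by positivity) h1
    have h3 : ∑ k ∈ t, φ k r = 1 := by
      simp only [φ, max_eq_left h1]
      rw [← Complex.ofReal_sum, ← Finset.sum_div, div_self hW0.ne', Complex.ofReal_one]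
    have h4 : f r - g r = ∑ k ∈ t, φ k r • (f r - k) := by
      simp only [smul_sub, Finset.sum_sub_distrib, ← Finset.sum_smul, h3, one_smul, g]
    rw [h4]
    calc ‖∑ k ∈ t, φ k r • (f r - k)‖ ≤ ∑ k ∈ t, ‖φ k r‖ * e := by
          refine norm_sum_le_of_le _ fun k _ => ?_
          rw [norm_smul]
          rcases le_total (‖f r - k‖) e with h | h
          · gcongr
          · have : w k (f r) = 0 := max_eq_left (by linarith)
            rw [hφn, this]; simp
      _ = e := by
          simp only [hφn, max_eq_left h1]
          rw [← Finset.sum_mul, ← Finset.sum_div, div_self hW0.ne', one_mul]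
  have hsplit : M.SD f s = M.SD (fun r => f r - g r) s + ∑ k ∈ t, M.SD (fun r => φ k r • k) s := by
    have h1 := M.SD_add (fun r => f r - g r) g (hf.sub hgc) hgc s hs.1
    simp only [sub_add_cancel] at h1
    have h2 : M.SD g s = ∑ k ∈ t, M.SD (fun r => φ k r • k) s :=
      M.SD_sum t (fun k r => φ k r • k) (fun k _ => (hφc k).smul continuousOn_const) s hs.1
    rw [← h2]; exact h1
  have hdec : z (M.SD f s - M.A n (M.SD f s)) =
      z (M.SD (fun r => f r - g r) s - M.A n (M.SD (fun r => f r - g r) s)) +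
      ∑ k ∈ t, z (M.SD (fun r => φ k r • k) s - M.A n (M.SD (fun r => φ k r • k) s)) := by
    rw [hsplit]
    simp only [map_add, map_sum, map_sub, Finset.sum_sub_distrib]
    ring
  rw [hdec]
  have b1 : ‖z (M.SD (fun r => f r - g r) s - M.A n (M.SD (fun r => f r - g r) s))‖ ≤ ε / 2 := by
    have h1 : ‖M.SD (fun r => f r - g r) s‖ ≤ M.δ τ * e := by
      refine (M.SD_norm_le _ (hf.sub hgc) s hs.1 e
        (fun r hr => herr r ⟨hr.1, hr.2.trans hs.2⟩)).trans ?_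
      gcongr
      exact M.δ_mono hs.1 hτ.le hs.2
    calc _ ≤ ‖z‖ * (‖M.SD (fun r => f r - g r) s‖ + C * ‖M.SD (fun r => f r - g r) s‖) := by
          refine (z.le_opNorm _).trans ?_
          gcongr
          refine (norm_sub_le _ _).trans ?_
          gcongr
          exact M.A_norm C hC n _
      _ ≤ ‖z‖ * (M.δ τ * e + C * (M.δ τ * e)) := by gcongr
      _ = (D - 1) * e := by rw [hD]; ring
      _ ≤ D * e := by gcongr; linarith
      _ = ε / 2 := by rw [he]; field_simp
  have b2 : ‖∑ k ∈ t, z (M.SD (fun r => φ k r • k) s - M.A n (M.SD (fun r => φ k r • k) s))‖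
      ≤ ε / 2 := by
    calc _ ≤ ∑ k ∈ t, ε / (2 * ((t.card : ℝ) + 1)) := by
          refine norm_sum_le_of_le _ fun k hk => ?_
          exact hN k n (Finset.le_sup hk) (φ k) (hφc k) (fun r _ => hφ1 k hk r) s hs
      _ ≤ ε / 2 := by
          rw [Finset.sum_const, nsmul_eq_mul, mul_div_assoc', div_le_div_iff₀ (by positivity) (by positivity)]
          nlinarith
  calc _ ≤ _ := norm_add_le _ _
    _ ≤ ε / 2 + ε / 2 := add_le_add b1 b2
    _ = ε := by ring

end MRSetting

/-- Uniform (in `s`) total boundedness of the image of the unit ball, via finite colourings. -/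
def TB {G E : Type*} [NormedAddCommGroup G] [NormedAddCommGroup E] (τ : ℝ) (w : ℝ → G → E) : Prop :=
  ∀ ε > 0, ∃ (N : ℕ) (c : G → Fin N), ∀ x y, ‖x‖ ≤ 1 → ‖y‖ ≤ 1 → c x = c y →
    ∀ s ∈ Icc (0:ℝ) τ, ‖w s x - w s y‖ ≤ ε

section TBsec
variable {G E F : Type*} [NormedAddCommGroup G] [NormedAddCommGroup E] [NormedAddCommGroup F]

lemma fin_color {ι : Type*} [Finite ι] (c : G → ι) {P : G → G → Prop}
    (h : ∀ x y, ‖x‖ ≤ 1 → ‖y‖ ≤ 1 → c x = c y → P x y) :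
    ∃ (N : ℕ) (c : G → Fin N), ∀ x y, ‖x‖ ≤ 1 → ‖y‖ ≤ 1 → c x = c y → P x y := by
  obtain ⟨n, ⟨e⟩⟩ := Finite.exists_equiv_fin ι
  exact ⟨n, e ∘ c, fun x y hx hy hc => h x y hx hy (e.injective hc)⟩

lemma color_of_tb (f : G → E) (K : Set E) (hK : TotallyBounded K) (hf : ∀ x, ‖x‖ ≤ 1 → f x ∈ K)
    (ε : ℝ) (hε : 0 < ε) :
    ∃ (N : ℕ) (c : G → Fin N), ∀ x y, ‖x‖ ≤ 1 → ‖y‖ ≤ 1 → c x = c y → ‖f x - f y‖ ≤ ε := by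
  obtain ⟨t, htf, ht⟩ := Metric.totallyBounded_iff.1 hK (ε / 2) (by positivity)
  have : ∀ x : G, ∃ k : Option t, ‖x‖ ≤ 1 → ∃ k' : t, k = some k' ∧ ‖f x - k'‖ < ε / 2 := by
    intro x
    by_cases hx : ‖x‖ ≤ 1
    · have := ht (hf x hx)
      simp only [mem_iUnion, Metric.mem_ball, dist_eq_norm] at this
      obtain ⟨k, hk, hkx⟩ := this
      exact ⟨some ⟨k, hk⟩, fun _ => ⟨_, rfl, hkx⟩⟩
    · exact ⟨none, fun h => absurd h hx⟩
  choose c hc using this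
  have : Finite t := htf
  refine fin_color c fun x y hx hy hxy => ?_
  obtain ⟨k, hk, h1⟩ := hc x hx
  obtain ⟨l, hl, h2⟩ := hc y hy
  have hkl : k = l := by rw [hk, hl] at hxy; exact Option.some_injective _ hxy
  subst hkl
  rw [norm_sub_rev] at h2
  calc ‖f x - f y‖ = ‖(f x - k) + (k - f y)‖ := by congr 1; abel
    _ ≤ _ := norm_add_le _ _
    _ ≤ ε := by linarith

variable [NormedSpace ℂ G] [NormedSpace ℂ E] [NormedSpace ℂ F]

lemma TB.compact [CompleteSpace E] {τ : ℝ} {W : ℝ → G →L[ℂ] E} (h : TB τ (fun s x => W s x))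
    (s : ℝ) (hs : s ∈ Icc (0:ℝ) τ) : IsCompactOperator (W s) := by
  refine (isCompactOperator_iff_isCompact_closure_image_closedBall (W s).toLinearMap one_pos).2 ?_
  refine TotallyBounded.isCompact_of_isClosed (TotallyBounded.closure ?_) isClosed_closure
  rw [Metric.totallyBounded_iff]
  intro ε hε
  obtain ⟨N, c, hc⟩ := h (ε / 2) (by positivity)
  classical
  let g : Fin N → G := fun i => if hi : ∃ x, ‖x‖ ≤ 1 ∧ c x = i then hi.choose else 0
  refine ⟨Set.range fun i => W s (g i), Set.finite_range _, ?_⟩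
  rintro _ ⟨x, hx, rfl⟩
  have hx' : ‖x‖ ≤ 1 := by simpa using hx
  simp only [mem_iUnion]
  refine ⟨_, ⟨c x, rfl⟩, ?_⟩
  have hi : ∃ x', ‖x'‖ ≤ 1 ∧ c x' = c x := ⟨x, hx', rfl⟩
  have hg : g (c x) = hi.choose := dif_pos hi
  rw [Metric.mem_ball, dist_eq_norm]
  have h2 := hc x (g (c x)) hx' (by rw [hg]; exact hi.choose_spec.1)
    (by rw [hg]; exact hi.choose_spec.2.symm) s hs
  refine lt_of_le_of_lt h2 (by linarith)

lemma TB.clm {τ : ℝ} {w : ℝ → G → E} (h : TB τ w) (Q : E →L[ℂ] F) : TB τ (fun s x => Q (w s x)) := by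
  intro ε hε
  obtain ⟨N, c, hc⟩ := h (ε / (‖Q‖ + 1)) (by positivity)
  refine ⟨N, c, fun x y hx hy hxy s hs => ?_⟩
  rw [← map_sub]
  calc _ ≤ ‖Q‖ * ‖w s x - w s y‖ := Q.le_opNorm _
    _ ≤ (‖Q‖ + 1) * (ε / (‖Q‖ + 1)) := by
      gcongr
      · linarith
      · exact hc x y hx hy hxy s hs
    _ = ε := by field_simp

end TBsec

namespace MRSetting

variable (M : MRSetting X X₀) (L : X₀ →L[ℂ] X)

lemma LU_cont {U : ℝ → X₀ →L[ℂ] X₀} (hU : ∀ x, ContinuousOn (fun t => U t x) (Ici 0)) (x : X₀) :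
    ContinuousOn (fun t => L (U t x)) (Ici 0) := L.continuous.comp_continuousOn (hU x)

lemma Bop_apply {U : ℝ → X₀ →L[ℂ] X₀} (hU : ∀ x, ContinuousOn (fun t => U t x) (Ici 0)) (t : ℝ)
    (x : X₀) : M.Bop L U t x = M.SD (fun s => L (U s x)) t :=
  M.SDop_apply (fun s => L.comp (U s)) (fun x => LU_cont L hU x) t x

lemma Bop_cont {U : ℝ → X₀ →L[ℂ] X₀} (hU : ∀ x, ContinuousOn (fun t => U t x) (Ici 0)) (x : X₀) :
    ContinuousOn (fun t => M.Bop L U t x) (Ici 0) := by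
  simp only [M.Bop_apply L hU]
  exact M.SD_cont _ (LU_cont L hU x)

lemma Bop_shift {U : ℝ → X₀ →L[ℂ] X₀} (hU : ∀ x, ContinuousOn (fun t => U t x) (Ici 0)) (t s : ℝ)
    (ht : 0 ≤ t) (hs : 0 ≤ s) (x : X₀) : M.Bop L U (t + s) x =
      M.T s (M.Bop L U t x) + M.SD (fun r => L (U (t + r) x)) s := by
  rw [M.Bop_apply L hU, M.Bop_apply L hU, M.SD_shift _ (LU_cont L hU x) t s ht hs]

lemma S1_add (t s : ℝ) (ht : 0 ≤ t) (hs : 0 ≤ s) (x : X₀) :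
    M.Bop L M.T (t + s) x = M.T s (M.Bop L M.T t x) + M.Bop L M.T s (M.T t x) := by
  rw [M.Bop_shift L M.T_cont t s ht hs, M.Bop_apply L M.T_cont s]
  congr 1
  refine M.SD_congr _ _ (M.shift_cont (LU_cont L M.T_cont x) ht) (LU_cont L M.T_cont _) s hs ?_
  intro r hr
  rw [add_comm, M.T_add r t hr.1 ht]; rfl

lemma S2_add (t s : ℝ) (ht : 0 ≤ t) (hs : 0 ≤ s) (x : X₀) :
    M.Bop L (M.Bop L M.T) (t + s) x = M.T s (M.Bop L (M.Bop L M.T) t x) +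
      M.Bop L M.T s (M.Bop L M.T t x) + M.Bop L (M.Bop L M.T) s (M.T t x) := by
  have hS := M.Bop_cont L M.T_cont
  rw [M.Bop_shift L hS t s ht hs, M.Bop_apply L hS s, M.Bop_apply L M.T_cont s, add_assoc,
    ← M.SD_add _ _ (LU_cont L M.T_cont _) (LU_cont L hS _) s hs]
  congr 1
  refine M.SD_congr _ _ (M.shift_cont (LU_cont L hS x) ht)
    ((LU_cont L M.T_cont _).add (LU_cont L hS _)) s hs ?_
  intro r hr
  rw [M.S1_add L t r ht hr.1, map_add]; rfl

lemma S1_small (ε : ℝ) (hε : 0 < ε) :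
    ∃ η > 0, η ≤ 1 ∧ ∀ d ∈ Icc (0:ℝ) η, ‖M.Bop L M.T d‖ ≤ ε := by
  have := M.complete
  obtain ⟨C, hC0, hC⟩ := locbdd M.T M.T_cont 1
  have h1 : ∀ᶠ t in 𝓝[>] (0:ℝ), M.δ t < ε / ((‖L‖ + 1) * C) :=
    M.δ_lim.eventually_lt_const (by positivity)
  have h2 : ∀ᶠ t in 𝓝[>] (0:ℝ), t < 1 := by
    filter_upwards [Ioo_mem_nhdsGT (zero_lt_one' ℝ)] with t ht using ht.2
  obtain ⟨η, ⟨h3, h4⟩, h5⟩ := ((h1.and h2).and self_mem_nhdsWithin).exists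
  refine ⟨η, h5, h4.le, fun d hd => ?_⟩
  refine ContinuousLinearMap.opNorm_le_bound _ hε.le fun x => ?_
  rw [M.Bop_apply L M.T_cont]
  have hδ := M.δ_nonneg d hd.1
  calc _ ≤ M.δ d * ((‖L‖ + 1) * C * ‖x‖) := by
        refine M.SD_norm_le _ (LU_cont L M.T_cont x) d hd.1 _ fun s hs => ?_
        calc ‖L (M.T s x)‖ ≤ ‖L‖ * ‖M.T s x‖ := L.le_opNorm _
          _ ≤ (‖L‖ + 1) * (C * ‖x‖) := by
            gcongr
            · linarith
            · exact (M.T s).le_of_opNorm_le (hC s ⟨hs.1, by linarith [hs.2, hd.2]⟩) x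
          _ = _ := by ring
    _ ≤ ε / ((‖L‖ + 1) * C) * ((‖L‖ + 1) * C * ‖x‖) := by
        gcongr
        exact (M.δ_mono hd.1 (le_of_lt h5) hd.2).trans h3.le
    _ = ε * ‖x‖ := by field_simp

lemma A_T (C : ℝ) (hC : ∀ t ∈ Icc (0:ℝ) 2, ‖M.T t‖ ≤ C) (n : ℕ) (d : ℝ) (hd : d ∈ Icc (0:ℝ) 1)
    (y : X₀) : ‖M.A n (M.T d y - y)‖ ≤ ((n:ℝ) + 1) * (2 * d * (C * ‖y‖)) := by
  have hn : (0:ℝ) < (n:ℝ) + 1 := by positivity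
  have := M.complete
  rw [map_sub, A_apply, A_apply, ← smul_sub, norm_smul, Real.norm_of_nonneg hn.le]
  set h : ℝ := 1 / ((n:ℝ) + 1) with hh
  have h0 : 0 ≤ h := by positivity
  have h1 : h ≤ 1 := by rw [hh, div_le_one hn]; linarith [Nat.cast_nonneg (α := ℝ) n]
  gcongr
  have e1 : ∫ u in (0:ℝ)..h, M.T u (M.T d y) = ∫ u in d..(h + d), M.T u y := by
    have := intervalIntegral.integral_comp_add_right (a := 0) (b := h) (fun u => M.T u y) d
    rw [zero_add] at this
    rw [← this]
    apply intervalIntegral.integral_congr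
    intro u hu
    rw [uIcc_of_le h0] at hu
    simp only
    rw [M.T_add u d hu.1 hd.1]; rfl
  have hi := fun a b ha hb => M.T_ii y a b ha hb
  have hd0 := hd.1
  have e2 : (∫ u in d..(h + d), M.T u y) - ∫ u in (0:ℝ)..h, M.T u y =
      (∫ u in h..(h + d), M.T u y) - ∫ u in (0:ℝ)..d, M.T u y := by
    have a1 := intervalIntegral.integral_add_adjacent_intervals (hi 0 d le_rfl hd0)
      (hi d (h + d) hd0 (by positivity))
    have a2 := intervalIntegral.integral_add_adjacent_intervals (hi 0 h le_rfl h0)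
      (hi h (h + d) h0 (by positivity))
    rw [sub_eq_sub_iff_add_eq_add, add_comm, a1, ← a2, add_comm]
  rw [e1, e2]
  have b : ∀ a, 0 ≤ a → a ≤ 1 → ‖∫ u in a..(a + d), M.T u y‖ ≤ C * ‖y‖ * d := by
    intro a ha ha1
    have := intervalIntegral.norm_integral_le_of_norm_le_const (a := a) (b := a + d)
      (f := fun u => M.T u y) (C := C * ‖y‖) (by
        intro u hu
        rw [uIoc_of_le (by linarith)] at hu
        exact (M.T u).le_of_opNorm_le (hC u ⟨by linarith [hu.1], by linarith [hu.2, hd.2]⟩) y)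
    rwa [add_sub_cancel_left, abs_of_nonneg hd0] at this
  have b1 := b h h0 h1
  have b2 := b 0 le_rfl zero_le_one
  rw [zero_add] at b2
  calc _ ≤ _ := norm_sub_le _ _
    _ ≤ _ := by linarith

lemma lemD (z : X₀ →L[ℂ] ℂ) (Q : X₀ →L[ℂ] X₀) (n : ℕ) (τ : ℝ) (hτ : 0 < τ) :
    TB τ (fun s x => z (M.A n (M.Bop L M.T s (Q x)))) := by
  have := M.complete
  intro ε hε
  obtain ⟨C, hC0, hC⟩ := locbdd M.T M.T_cont (τ + 2)
  obtain ⟨C1, hC10, hC1⟩ := locbdd (M.Bop L M.T) (M.Bop_cont L M.T_cont) τ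
  have hCA : ∀ t ∈ Icc (0:ℝ) 1, ‖M.T t‖ ≤ C := fun t ht => hC t ⟨ht.1, by linarith [ht.2]⟩
  set q := ‖Q‖ + 1 with hq
  have hq0 : 0 < q := by positivity
  set e := ε / (12 * (‖z‖ + 1) * q) with he
  have he0 : 0 < e := by positivity
  obtain ⟨η1, hη10, hη11, hη1⟩ := M.S1_small L (e / (C * C)) (by positivity)
  set η := min η1 (e / (((n:ℝ) + 1) * 2 * (C * C1))) with hη
  have hη0 : 0 < η := by positivity
  -- modulus
  have hmod : ∀ s d, 0 ≤ s → 0 ≤ d → d ≤ η → s + d ≤ τ → ∀ y : X₀,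
      ‖M.A n (M.Bop L M.T (s + d) y) - M.A n (M.Bop L M.T s y)‖ ≤ 2 * e * ‖y‖ := by
    intro s d hs hd hdη hsd y
    rw [M.S1_add L s d hs hd, ← map_sub]
    have : M.T d (M.Bop L M.T s y) + M.Bop L M.T d (M.T s y) - M.Bop L M.T s y =
      (M.T d (M.Bop L M.T s y) - M.Bop L M.T s y) + M.Bop L M.T d (M.T s y) := by abel
    rw [this, map_add]
    have hd1 : d ≤ η1 := hdη.trans (min_le_left _ _)
    have hd2 : d ≤ e / (((n:ℝ) + 1) * 2 * (C * C1)) := hdη.trans (min_le_right _ _)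
    have b1 : ‖M.A n (M.T d (M.Bop L M.T s y) - M.Bop L M.T s y)‖ ≤ e * ‖y‖ := by
      refine (M.A_T C (fun t ht => hC t ⟨ht.1, by linarith [ht.2]⟩) n d ⟨hd, hd1.trans hη11⟩ _).trans ?_
      have := (M.Bop L M.T s).le_of_opNorm_le (hC1 s ⟨hs, by linarith⟩) y
      calc _ ≤ ((n:ℝ) + 1) * (2 * (e / (((n:ℝ) + 1) * 2 * (C * C1))) * (C * (C1 * ‖y‖))) := by gcongr
        _ = _ := by field_simp
    have b2 : ‖M.A n (M.Bop L M.T d (M.T s y))‖ ≤ e * ‖y‖ := by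
      refine (M.A_norm C hCA n _).trans ?_
      have h1 := (M.Bop L M.T d).le_of_opNorm_le (hη1 d ⟨hd, hd1⟩) (M.T s y)
      have h2 := (M.T s).le_of_opNorm_le (hC s ⟨hs, by linarith⟩) y
      calc _ ≤ C * (e / (C * C) * (C * ‖y‖)) := by
            gcongr
            refine h1.trans ?_
            gcongr
        _ = _ := by field_simp
    calc _ ≤ _ := norm_add_le _ _
      _ ≤ _ := by linarith
  set m := ⌊τ / η⌋₊ with hm
  let F : X₀ → (Fin (m + 1) → ℂ) := fun x i => z (M.A n (M.Bop L M.T (i * η) (Q x)))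
  have hpt : ∀ i : Fin (m + 1), (i:ℝ) * η ∈ Icc (0:ℝ) τ := by
    intro i
    refine ⟨by positivity, ?_⟩
    have h1 : ((i:ℕ):ℝ) ≤ m := by exact_mod_cast Nat.lt_succ_iff.1 i.2
    have h2 : (m:ℝ) ≤ τ / η := Nat.floor_le (by positivity)
    rw [← le_div_iff₀ hη0]; linarith
  obtain ⟨N, c, hc⟩ := color_of_tb F (Metric.closedBall 0 (‖z‖ * (C * (C1 * (‖Q‖ * 1)))))
    (isCompact_closedBall _ _).totallyBounded (by
      intro x hx
      rw [mem_closedBall_zero_iff]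
      refine (pi_norm_le_iff_of_nonneg (by positivity)).2 fun i => ?_
      refine (z.le_opNorm _).trans ?_
      gcongr
      refine (M.A_norm C hCA n _).trans ?_
      gcongr
      refine ((M.Bop L M.T _).le_of_opNorm_le (hC1 _ (hpt i)) _).trans ?_
      gcongr
      refine (Q.le_opNorm _).trans ?_
      gcongr) (ε / 3) (by positivity)
  refine ⟨N, c, fun x y hx hy hxy s hs => ?_⟩
  have hi : ⌊s / η⌋₊ < m + 1 := Nat.lt_succ_iff.2 (Nat.floor_mono (by
    gcongr; exact hs.2))
  let i : Fin (m + 1) := ⟨⌊s / η⌋₊, hi⟩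
  have hs1 : (i:ℝ) * η ≤ s := by
    rw [← le_div_iff₀ hη0]; exact Nat.floor_le (div_nonneg hs.1 hη0.le)
  have hs2 : s - (i:ℝ) * η ≤ η := by
    have := (Nat.lt_floor_add_one (s / η)).le
    rw [div_le_iff₀ hη0] at this
    change s - (⌊s / η⌋₊ : ℝ) * η ≤ η
    linarith
  have hb : ∀ x : X₀, ‖x‖ ≤ 1 → ‖z (M.A n (M.Bop L M.T s (Q x))) - F x i‖ ≤ ε / 3 := by
    intro x hx
    have h1 := hmod (i * η) (s - i * η) (hpt i).1 (by linarith) hs2 (by linarith [hs.2]) (Q x)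
    rw [add_sub_cancel] at h1
    change ‖z _ - z _‖ ≤ _
    rw [← map_sub]
    refine (z.le_opNorm _).trans ?_
    have h2 : ‖Q x‖ ≤ q := by
      calc ‖Q x‖ ≤ ‖Q‖ * ‖x‖ := Q.le_opNorm _
        _ ≤ ‖Q‖ * 1 := by gcongr
        _ ≤ q := by rw [hq]; linarith
    calc _ ≤ (‖z‖ + 1) * (2 * e * q) := by
          gcongr
          · linarith
          · exact h1.trans (by gcongr)
      _ = ε / 6 := by rw [he]; field_simp; norm_num
      _ ≤ ε / 3 := by linarith
  have h1 := hb x hx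
  have h2 := hb y hy
  rw [norm_sub_rev] at h2
  have h3 : ‖F x i - F y i‖ ≤ ε / 3 := (norm_le_pi_norm (F x - F y) i).trans (hc x y hx hy hxy)
  calc _ = ‖(z (M.A n (M.Bop L M.T s (Q x))) - F x i) + (F x i - F y i) +
        (F y i - z (M.A n (M.Bop L M.T s (Q y))))‖ := by congr 1; ring
    _ ≤ _ := norm_add₃_le
    _ ≤ ε := by linarith

end MRSetting

namespace MRSetting

variable (M : MRSetting X X₀) (L : X₀ →L[ℂ] X)

lemma T_comm (t s : ℝ) (ht : 0 ≤ t) (hs : 0 ≤ s) (x : X₀) : M.T t (M.T s x) = M.T s (M.T t x) := by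
  have h1 := M.T_add t s ht hs
  have h2 := M.T_add s t hs ht
  rw [add_comm, h2] at h1
  exact (congrArg (fun W : X₀ →L[ℂ] X₀ => W x) h1).symm

lemma lemE (hLT : ∀ t : ℝ, 0 < t → IsCompactOperator ⇑(L.comp (M.T t)))
    (p : ℝ) (hp : 1 ≤ p) (Mhat ωhat : ℝ) (hMhat : 0 ≤ Mhat)
    (hq : ∀ f : ℝ → X, ContinuousOn f (Ici 0) → ∀ t ∈ Ici (0:ℝ),
      ‖M.SD f t‖ ≤ Mhat * (∫ s in (0:ℝ)..t, Real.exp (p * ωhat * (t - s)) * ‖f s‖ ^ p) ^ (1 / p))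
    (z : X₀ →L[ℂ] ℂ) (η : ℝ) (hη : 0 < η) (τ : ℝ) (hτ : 0 < τ) :
    TB τ (fun s x => z (M.Bop L M.T s (M.T η x))) := by
  have := M.complete
  intro ε hε
  obtain ⟨C, hC0, hC⟩ := locbdd M.T M.T_cont τ
  have hK : TotallyBounded ((L.comp (M.T η)) '' Metric.closedBall 0 (2 * C)) :=
    ((hLT η hη).isCompact_closure_image_closedBall (f := (L.comp (M.T η)).toLinearMap)
      (2 * C)).totallyBounded.subset subset_closure
  obtain ⟨n, hn⟩ := M.compact_approx z _ hK τ hτ p hp Mhat ωhat hMhat hq (ε / 2) (by positivity)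
  obtain ⟨N, c, hc⟩ := M.lemD L z (M.T η) n τ hτ (ε / 2) (by positivity)
  refine ⟨N, c, fun x y hx hy hxy s hs => ?_⟩
  have h1 := hc x y hx hy hxy s hs
  have hxy2 : ‖x - y‖ ≤ 2 := (norm_sub_le _ _).trans (by linarith)
  have h2 := hn (fun r => L (M.T r (M.T η (x - y)))) (LU_cont L M.T_cont _) (by
    intro r hr
    refine ⟨M.T r (x - y), ?_, ?_⟩
    · rw [mem_closedBall_zero_iff]
      refine ((M.T r).le_of_opNorm_le (hC r hr) _).trans ?_
      nlinarith
    · exact congrArg L (M.T_comm _ _ hη.le hr.1 _)) s hs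
  rw [← M.Bop_apply L M.T_cont] at h2
  simp only [map_sub] at h1 h2 ⊢
  set a := z (M.Bop L M.T s (M.T η x))
  set b := z (M.Bop L M.T s (M.T η y))
  set a' := z (M.A n (M.Bop L M.T s (M.T η x)))
  set b' := z (M.A n (M.Bop L M.T s (M.T η y)))
  calc ‖a - b‖ = ‖(a - b - (a' - b')) + (a' - b')‖ := by congr 1; ring
    _ ≤ _ := norm_add_le _ _
    _ ≤ ε := by linarith

lemma lemF (hLT : ∀ t : ℝ, 0 < t → IsCompactOperator ⇑(L.comp (M.T t)))
    (p : ℝ) (hp : 1 ≤ p) (Mhat ωhat : ℝ) (hMhat : 0 ≤ Mhat)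
    (hq : ∀ f : ℝ → X, ContinuousOn f (Ici 0) → ∀ t ∈ Ici (0:ℝ),
      ‖M.SD f t‖ ≤ Mhat * (∫ s in (0:ℝ)..t, Real.exp (p * ωhat * (t - s)) * ‖f s‖ ^ p) ^ (1 / p))
    (η : ℝ) (hη : 0 < η) (τ : ℝ) (hτ : 0 < τ) :
    TB τ (fun s x => L (M.T η (M.Bop L M.T s (M.T η x)))) := by
  have := M.complete
  intro ε hε
  obtain ⟨C1, hC10, hC1⟩ := locbdd (M.Bop L M.T) (M.Bop_cont L M.T_cont) τ
  set V := L.comp (M.T η) with hV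
  set ρ := C1 * (‖M.T η‖ * 2) with hρ
  have hK : TotallyBounded (V '' Metric.closedBall 0 ρ) :=
    ((hLT η hη).isCompact_closure_image_closedBall (f := (L.comp (M.T η)).toLinearMap)
      ρ).totallyBounded.subset subset_closure
  obtain ⟨t, htf, ht⟩ := Metric.totallyBounded_iff.1 hK (ε / 4) (by positivity)
  choose g hg1 hg2 using fun k : X => exists_dual_vector'' ℂ k
  choose N c hc using fun k : t => M.lemE L hLT p hp Mhat ωhat hMhat hq ((g k).comp V) η hη τ hτ
    (ε / 4) (by positivity)
  have : Finite t := htf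
  refine fin_color (fun x k => c k x) fun x y hx hy hxy s hs => ?_
  set v := V (M.Bop L M.T s (M.T η (x - y))) with hv
  have e1 : L (M.T η (M.Bop L M.T s (M.T η x))) - L (M.T η (M.Bop L M.T s (M.T η y))) = v := by
    rw [hv]; simp only [map_sub]; rfl
  rw [e1]
  have hxy2 : ‖x - y‖ ≤ 2 := (norm_sub_le _ _).trans (by linarith)
  have hvK : v ∈ V '' Metric.closedBall 0 ρ := by
    refine ⟨_, ?_, rfl⟩
    rw [mem_closedBall_zero_iff]
    refine ((M.Bop L M.T s).le_of_opNorm_le (hC1 s hs) _).trans ?_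
    rw [hρ]
    gcongr
    exact ((M.T η).le_opNorm _).trans (by gcongr)
  have h1 := ht hvK
  simp only [mem_iUnion, Metric.mem_ball, dist_eq_norm] at h1
  obtain ⟨k, hk, hkv⟩ := h1
  have h2 := hc ⟨k, hk⟩ x y hx hy (congrFun hxy ⟨k, hk⟩) s hs
  rw [← map_sub, ← map_sub, ← map_sub] at h2
  change ‖g k v‖ ≤ _ at h2
  have h3 : ‖k‖ ≤ ‖g k v‖ + ‖v - k‖ := by
    have : ‖g k k‖ = ‖k‖ := by rw [hg2]; simp
    rw [← this]
    calc ‖g k k‖ = ‖g k v - g k (v - k)‖ := by rw [← map_sub]; simp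
      _ ≤ ‖g k v‖ + ‖g k (v - k)‖ := norm_sub_le _ _
      _ ≤ _ := by
        gcongr
        exact ((g k).le_of_opNorm_le (hg1 k) _).trans (by rw [one_mul])
  have h4 : ‖v‖ ≤ ‖v - k‖ + ‖k‖ := by
    calc ‖v‖ = ‖(v - k) + k‖ := by simp
      _ ≤ _ := norm_add_le _ _
  linarith

lemma lemG (hLT : ∀ t : ℝ, 0 < t → IsCompactOperator ⇑(L.comp (M.T t)))
    (p : ℝ) (hp : 1 ≤ p) (Mhat ωhat : ℝ) (hMhat : 0 ≤ Mhat)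
    (hq : ∀ f : ℝ → X, ContinuousOn f (Ici 0) → ∀ t ∈ Ici (0:ℝ),
      ‖M.SD f t‖ ≤ Mhat * (∫ s in (0:ℝ)..t, Real.exp (p * ωhat * (t - s)) * ‖f s‖ ^ p) ^ (1 / p))
    (τ : ℝ) (hτ : 0 < τ) :
    TB τ (fun s x => L (M.Bop L M.T s x)) := by
  have := M.complete
  intro ε hε
  obtain ⟨C, hC0, hC⟩ := locbdd M.T M.T_cont (τ + 2)
  set D := (‖L‖ + 1) * (C * C + C + 1) with hD
  have hD0 : 0 < D := by positivity
  obtain ⟨η2, hη20, hη21, hη2⟩ := M.S1_small L (ε / (4 * D)) (by positivity)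
  set η := η2 / 2 with hη
  have hη0 : 0 < η := by positivity
  obtain ⟨N, c, hc⟩ := M.lemF L hLT p hp Mhat ωhat hMhat hq η hη0 τ hτ (ε / 4) (by positivity)
  refine ⟨N, c, fun x y hx hy hxy s hs => ?_⟩
  have hxy2 : ‖x - y‖ ≤ 2 := (norm_sub_le _ _).trans (by linarith)
  have e0 : L (M.Bop L M.T s x) - L (M.Bop L M.T s y) = L (M.Bop L M.T s (x - y)) := by
    simp only [map_sub]
  rw [e0]
  have hLe : ‖L‖ ≤ ‖L‖ + 1 := by linarith
  rcases le_total s η2 with h | h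
  · calc _ ≤ ‖L‖ * ‖M.Bop L M.T s (x - y)‖ := L.le_opNorm _
      _ ≤ (‖L‖ + 1) * (ε / (4 * D) * 2) := by
        gcongr
        exact ((M.Bop L M.T s).le_of_opNorm_le (hη2 s ⟨hs.1, h⟩) _).trans (by gcongr)
      _ ≤ D * (ε / (4 * D) * 2) := by
        gcongr
        rw [hD]
        exact le_mul_of_one_le_right (by positivity) (by nlinarith [mul_pos hC0 hC0])
      _ = ε / 2 := by field_simp; norm_num
      _ ≤ ε := by linarith
  · obtain ⟨r, rfl⟩ : ∃ r, s = η + r + η := ⟨s - η2, by rw [hη]; ring⟩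
    have hr : 0 ≤ r := by rw [hη] at h; linarith
    have hrτ : r ≤ τ := by linarith [hs.2]
    have hηr : 0 ≤ η + r := by positivity
    set d := x - y with hd
    have e1 : M.Bop L M.T (η + r + η) d = M.T η (M.Bop L M.T r (M.T η d)) +
        (M.T η (M.T r (M.Bop L M.T η d)) + M.Bop L M.T η (M.T (η + r) d)) := by
      rw [M.S1_add L (η + r) η hηr hη0.le, M.S1_add L η r hη0.le hr, map_add]; abel
    rw [e1, map_add]
    have hηm : η ∈ Icc 0 η2 := ⟨hη0.le, by rw [hη]; linarith⟩
    have hSη := hη2 η hηm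
    have b1 : ‖L (M.T η (M.Bop L M.T r (M.T η d)))‖ ≤ ε / 4 := by
      have := hc x y hx hy hxy r ⟨hr, hrτ⟩
      rw [hd]; simpa only [map_sub] using this
    have b2 : ‖M.T η (M.T r (M.Bop L M.T η d))‖ ≤ C * (C * (ε / (4 * D) * 2)) := by
      refine ((M.T η).le_of_opNorm_le (hC η ⟨hη0.le, by linarith [hηm.2]⟩) _).trans ?_
      gcongr
      refine ((M.T r).le_of_opNorm_le (hC r ⟨hr, by linarith⟩) _).trans ?_
      gcongr
      exact ((M.Bop L M.T η).le_of_opNorm_le hSη _).trans (by gcongr)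
    have b3 : ‖M.Bop L M.T η (M.T (η + r) d)‖ ≤ ε / (4 * D) * (C * 2) := by
      refine ((M.Bop L M.T η).le_of_opNorm_le hSη _).trans ?_
      gcongr
      exact ((M.T _).le_of_opNorm_le (hC (η + r) ⟨hηr, by linarith [hηm.2]⟩) _).trans (by gcongr)
    have b4 : ‖L (M.T η (M.T r (M.Bop L M.T η d)) + M.Bop L M.T η (M.T (η + r) d))‖ ≤ ε / 2 := by
      calc _ ≤ ‖L‖ * _ := L.le_opNorm _
        _ ≤ (‖L‖ + 1) * (C * (C * (ε / (4 * D) * 2)) + ε / (4 * D) * (C * 2)) := by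
          gcongr
          exact (norm_add_le _ _).trans (add_le_add b2 b3)
        _ = ((‖L‖ + 1) * (C * C + C)) * (ε / (4 * D) * 2) := by ring
        _ ≤ D * (ε / (4 * D) * 2) := by
          gcongr
          rw [hD]; exact mul_le_mul_of_nonneg_left (by linarith) (by positivity)
        _ = ε / 2 := by field_simp; norm_num
    calc _ ≤ _ := norm_add_le _ _
      _ ≤ ε := by linarith

lemma lemH {U : ℝ → X₀ →L[ℂ] X₀} (hU : ∀ x, ContinuousOn (fun t => U t x) (Ici 0)) (τ : ℝ)
    (hτ : 0 < τ) (h : TB τ (fun s x => L (U s x))) : TB τ (fun s x => M.Bop L U s x) := by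
  intro ε hε
  have hδ := M.δ_nonneg τ hτ.le
  obtain ⟨N, c, hc⟩ := h (ε / (M.δ τ + 1)) (by positivity)
  refine ⟨N, c, fun x y hx hy hxy s hs => ?_⟩
  simp only
  rw [M.Bop_apply L hU, M.Bop_apply L hU, ← M.SD_sub _ _ (LU_cont L hU x) (LU_cont L hU y) s hs.1]
  calc _ ≤ M.δ s * (ε / (M.δ τ + 1)) :=
        M.SD_norm_le _ ((LU_cont L hU x).sub (LU_cont L hU y)) s hs.1 _ fun r hr =>
          hc x y hx hy hxy r ⟨hr.1, hr.2.trans hs.2⟩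
    _ ≤ (M.δ τ + 1) * (ε / (M.δ τ + 1)) := by
      gcongr
      linarith [M.δ_mono hs.1 hτ.le hs.2]
    _ = ε := by field_simp

lemma iter_cont {U : ℝ → X₀ →L[ℂ] X₀} (hU : ∀ x, ContinuousOn (fun t => U t x) (Ici 0)) (n : ℕ) :
    ∀ x, ContinuousOn (fun t => (M.Bop L)^[n] U t x) (Ici 0) := by
  induction n with
  | zero => exact hU
  | succ n ih => rw [Function.iterate_succ_apply']; exact M.Bop_cont L ih

lemma iter_compact (hLT : ∀ t : ℝ, 0 < t → IsCompactOperator ⇑(L.comp (M.T t)))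
    (p : ℝ) (hp : 1 ≤ p) (Mhat ωhat : ℝ) (hMhat : 0 ≤ Mhat)
    (hq : ∀ f : ℝ → X, ContinuousOn f (Ici 0) → ∀ t ∈ Ici (0:ℝ),
      ‖M.SD f t‖ ≤ Mhat * (∫ s in (0:ℝ)..t, Real.exp (p * ωhat * (t - s)) * ‖f s‖ ^ p) ^ (1 / p))
    (n : ℕ) (t : ℝ) (ht : 0 ≤ t) : IsCompactOperator ((M.Bop L)^[n + 2] M.T t) := by
  have := M.complete
  have h : ∀ n, TB (t + 1) (fun s x => L ((M.Bop L)^[n + 1] M.T s x)) := by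
    intro n
    induction n with
    | zero => exact M.lemG L hLT p hp Mhat ωhat hMhat hq (t + 1) (by positivity)
    | succ n ih =>
      rw [Function.iterate_succ_apply']
      exact (M.lemH L (M.iter_cont L M.T_cont _) (t + 1) (by positivity) ih).clm L
  have h2 := M.lemH L (M.iter_cont L M.T_cont _) (t + 1) (by positivity) (h n)
  rw [← Function.iterate_succ_apply' (M.Bop L)] at h2
  exact h2.compact t ⟨ht, by linarith⟩

end MRSetting

section EssSeminorm
variable {E : Type*} [NormedAddCommGroup E] [NormedSpace ℂ E]

/-- essential seminorm -/
def qess (W : E →L[ℂ] E) : ℝ := Metric.infDist W {K : E →L[ℂ] E | IsCompactOperator ⇑K}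

lemma qess_nonneg (W : E →L[ℂ] E) : 0 ≤ qess W := Metric.infDist_nonneg

lemma qess_le (W K : E →L[ℂ] E) (hK : IsCompactOperator K) : qess W ≤ ‖W - K‖ := by
  rw [← dist_eq_norm]; exact Metric.infDist_le_dist_of_mem hK

lemma qess_le_norm (W : E →L[ℂ] E) : qess W ≤ ‖W‖ := by
  have := qess_le W 0 isCompactOperator_zero
  rwa [sub_zero] at this

lemma qess_near (W : E →L[ℂ] E) (ε : ℝ) (hε : 0 < ε) :
    ∃ K : E →L[ℂ] E, IsCompactOperator K ∧ ‖W - K‖ < qess W + ε := by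
  have hne : {K : E →L[ℂ] E | IsCompactOperator ⇑K}.Nonempty := ⟨0, isCompactOperator_zero⟩
  obtain ⟨K, hK, h⟩ := (Metric.infDist_lt_iff (x := W) hne).1 (lt_add_of_pos_right (qess W) hε)
  exact ⟨K, hK, by rwa [← dist_eq_norm]⟩

lemma qess_cong (a b : E →L[ℂ] E) (h : IsCompactOperator ⇑(a - b)) : qess a ≤ qess b := by
  refine le_of_forall_pos_le_add fun ε hε => ?_
  obtain ⟨K, hK, hb⟩ := qess_near b ε hε
  have h1 := qess_le a ((a - b) + K) (h.add hK)
  have : a - ((a - b) + K) = b - K := by abel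
  rw [this] at h1
  linarith

lemma qess_add (a b : E →L[ℂ] E) : qess (a + b) ≤ qess a + qess b := by
  refine le_of_forall_pos_le_add fun ε hε => ?_
  obtain ⟨K, hK, ha⟩ := qess_near a (ε / 2) (by positivity)
  obtain ⟨K', hK', hb⟩ := qess_near b (ε / 2) (by positivity)
  have h1 := qess_le (a + b) (K + K') (hK.add hK')
  have : a + b - (K + K') = (a - K) + (b - K') := by abel
  rw [this] at h1
  have := norm_add_le (a - K) (b - K')
  linarith

lemma qess_neg (a : E →L[ℂ] E) : qess (-a) ≤ qess a := by
  refine le_of_forall_pos_le_add fun ε hε => ?_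
  obtain ⟨K, hK, ha⟩ := qess_near a ε hε
  have h1 := qess_le (-a) (-K) hK.neg
  have : -a - -K = -(a - K) := by abel
  rw [this, norm_neg] at h1
  linarith

lemma qess_comp (a b : E →L[ℂ] E) : qess (a.comp b) ≤ qess a * qess b := by
  have key : ∀ ε > 0, qess (a.comp b) ≤ (qess a + ε) * (qess b + ε) := by
    intro ε hε
    obtain ⟨K, hK, ha⟩ := qess_near a ε hε
    obtain ⟨K', hK', hb⟩ := qess_near b ε hε
    have hc : IsCompactOperator ⇑(a.comp K' + K.comp (b - K')) :=
      (hK'.clm_comp a).add (hK.comp_clm (b - K'))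
    have h1 := qess_le (a.comp b) _ hc
    have : a.comp b - (a.comp K' + K.comp (b - K')) = (a - K).comp (b - K') := by
      ext x; simp only [sub_apply, ContinuousLinearMap.comp_apply,
        add_apply, map_sub]; abel
    rw [this] at h1
    refine h1.trans ((ContinuousLinearMap.opNorm_comp_le _ _).trans ?_)
    have := qess_nonneg a
    gcongr
  have hlim : Tendsto (fun ε : ℝ => (qess a + ε) * (qess b + ε)) (𝓝[>] 0)
      (𝓝 ((qess a + 0) * (qess b + 0))) := by
    apply tendsto_nhdsWithin_of_tendsto_nhds
    exact Continuous.tendsto (by fun_prop) 0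
  rw [add_zero, add_zero] at hlim
  refine ge_of_tendsto hlim ?_
  filter_upwards [self_mem_nhdsWithin] with ε hε using key ε hε

lemma growth (Q P : ℝ → E →L[ℂ] E)
    (hrel : ∀ t s, 0 ≤ t → 0 ≤ s →
      IsCompactOperator ⇑(Q (t + s) - ((P s).comp (Q t) + (Q s).comp (P t))))
    (hQ : ∀ τ, ∃ C, 0 < C ∧ ∀ t ∈ Icc (0:ℝ) τ, ‖Q t‖ ≤ C)
    (w w' C : ℝ) (hw : w < w') (hC : 0 ≤ C) (hP : ∀ t, 0 ≤ t → qess (P t) ≤ C * Real.exp (w * t)) :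
    ∃ C', 0 ≤ C' ∧ ∀ t, 0 ≤ t → qess (Q t) ≤ C' * Real.exp (w' * t) := by
  obtain ⟨h, hh0, hh⟩ : ∃ h : ℝ, 0 < h ∧ C * Real.exp ((w - w') * h) ≤ 1 / 2 := by
    have h1 : Tendsto (fun h : ℝ => C * Real.exp ((w - w') * h)) atTop (𝓝 (C * 0)) := by
      refine Tendsto.const_mul _ (Real.tendsto_exp_atBot.comp ?_)
      exact tendsto_id.const_mul_atTop_of_neg (by linarith)
    rw [mul_zero] at h1
    obtain ⟨h, h2, h3⟩ := ((h1.eventually_lt_const (by norm_num : (0:ℝ) < 1 / 2)).and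
      (eventually_gt_atTop 0)).exists
    exact ⟨h, h3, h2.le⟩
  obtain ⟨C0, hC00, hC0⟩ := hQ h
  set D := qess (Q h) * C * Real.exp (-(w' * h)) with hD
  have hqh := qess_nonneg (Q h)
  have hD0 : 0 ≤ D := by positivity
  set B := C0 * Real.exp (|w'| * h) + 2 * D with hB
  have hB0 : 0 ≤ B := by positivity
  have key : ∀ n : ℕ, ∀ t, 0 ≤ t → t ≤ ((n:ℝ) + 1) * h → qess (Q t) ≤ B * Real.exp (w' * t) := by
    intro n
    induction n with
    | zero =>
      intro t ht hth
      have hth : t ≤ h := by simpa using hth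
      have h1 : 1 ≤ Real.exp (|w'| * h) * Real.exp (w' * t) := by
        rw [← Real.exp_add]
        apply Real.one_le_exp
        have : -(w' * t) ≤ |w'| * h := by
          calc -(w' * t) = (-w') * t := by ring
            _ ≤ |w'| * h := mul_le_mul (neg_le_abs _) hth ht (abs_nonneg _)
        linarith
      calc qess (Q t) ≤ C0 := (qess_le_norm _).trans (hC0 t ⟨ht, hth⟩)
        _ ≤ C0 * (Real.exp (|w'| * h) * Real.exp (w' * t)) := le_mul_of_one_le_right hC00.le h1
        _ = (C0 * Real.exp (|w'| * h)) * Real.exp (w' * t) := by ring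
        _ ≤ B * Real.exp (w' * t) := by gcongr; linarith
    | succ n ih =>
      intro t ht hth
      rcases le_total t h with hle | hle
      · refine ih t ht (hle.trans ?_)
        nlinarith [Nat.cast_nonneg (α := ℝ) n]
      · obtain ⟨r, rfl⟩ : ∃ r, t = r + h := ⟨t - h, by ring⟩
        have hr : 0 ≤ r := by linarith
        have h1 := ih r hr (by push_cast at hth; linarith)
        have h2 := qess_cong _ _ (hrel r h hr hh0.le)
        have h3 := qess_add ((P h).comp (Q r)) ((Q h).comp (P r))
        have h4 := qess_comp (P h) (Q r)
        have h5 := qess_comp (Q h) (P r)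
        have h6 : qess (P h) * qess (Q r) ≤ (C * Real.exp (w * h)) * (B * Real.exp (w' * r)) := by
          have := qess_nonneg (Q r)
          gcongr
          exact hP h hh0.le
        have h7 : qess (Q h) * qess (P r) ≤ qess (Q h) * (C * Real.exp (w' * r)) := by
          gcongr
          refine (hP r hr).trans ?_
          gcongr
        have e1 : Real.exp (w * h) = Real.exp ((w - w') * h) * Real.exp (w' * h) := by
          rw [← Real.exp_add]; congr 1; ring
        have e2 : Real.exp (w' * (r + h)) = Real.exp (w' * h) * Real.exp (w' * r) := by
          rw [← Real.exp_add]; congr 1; ring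
        have e3 : qess (Q h) * (C * Real.exp (w' * r)) = D * Real.exp (w' * (r + h)) := by
          rw [hD, e2, Real.exp_neg]; field_simp
        have h8 : (C * Real.exp (w * h)) * (B * Real.exp (w' * r)) ≤
            1 / 2 * B * Real.exp (w' * (r + h)) := by
          rw [e1, e2]
          calc _ = (C * Real.exp ((w - w') * h)) * (B * (Real.exp (w' * h) * Real.exp (w' * r))) := by
                ring
            _ ≤ 1 / 2 * (B * (Real.exp (w' * h) * Real.exp (w' * r))) := by gcongr
            _ = _ := by ring
        have h9 : (1 / 2 * B + D) * Real.exp (w' * (r + h)) ≤ B * Real.exp (w' * (r + h)) := by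
          gcongr
          have : 0 ≤ C0 * Real.exp (|w'| * h) := by positivity
          linarith
        linarith
  refine ⟨B, hB0, fun t ht => ?_⟩
  refine key ⌈t / h⌉₊ t ht ?_
  have := Nat.le_ceil (t / h)
  rw [div_le_iff₀ hh0] at this
  nlinarith

end EssSeminorm

lemma tendsto_zero_of_bound {E : Type*} [NormedAddCommGroup E] [NormedSpace ℂ E]
    (F : ℕ → E →L[ℂ] E) (b : ℕ → ℝ) (h : ∀ n, ‖F n‖ ≤ b n) (hb : Tendsto b atTop (𝓝 0)) :
    Tendsto F atTop (𝓝 0) := squeeze_zero_norm h hb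

lemma omegaEss_le {W V : ℝ → X₀ →L[ℂ] X₀}
    (h : ∀ w w' C : ℝ, w < w' → 0 ≤ C → (∀ t, 0 ≤ t → qess (V t) ≤ C * Real.exp (w * t)) →
      ∃ C', 0 ≤ C' ∧ ∀ t, 0 ≤ t → qess (W t) ≤ C' * Real.exp (w' * t)) :
    omegaEss W ≤ omegaEss V := by
  refine le_sInf ?_
  rintro _ ⟨w, ⟨C, hC, hw⟩, rfl⟩
  refine le_of_forall_gt_imp_ge_of_dense fun a ha => ?_
  obtain ⟨w', h1, h2⟩ := EReal.lt_iff_exists_real_btwn.1 ha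
  refine le_trans (sInf_le ?_) h2.le
  obtain ⟨C', h3, h4⟩ := h w w' C (EReal.coe_lt_coe_iff.1 h1) hC hw
  exact ⟨w', ⟨C', h3, h4⟩, rfl⟩

namespace MRSetting

variable (M : MRSetting X X₀) (L : X₀ →L[ℂ] X)

lemma Bop_add {U V W : ℝ → X₀ →L[ℂ] X₀} (hU : ∀ x, ContinuousOn (fun t => U t x) (Ici 0))
    (hV : ∀ x, ContinuousOn (fun t => V t x) (Ici 0))
    (hW : ∀ x, ContinuousOn (fun t => W t x) (Ici 0))
    (h : ∀ t, 0 ≤ t → U t = V t + W t) (t : ℝ) (ht : 0 ≤ t) :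
    M.Bop L U t = M.Bop L V t + M.Bop L W t := by
  ext1 x
  rw [add_apply, M.Bop_apply L hU, M.Bop_apply L hV, M.Bop_apply L hW,
    ← M.SD_add _ _ (LU_cont L hV x) (LU_cont L hW x) t ht]
  refine M.SD_congr _ _ (LU_cont L hU x) ((LU_cont L hV x).add (LU_cont L hW x)) t ht ?_
  intro s hs
  simp only [h s hs.1, add_apply, map_add, Pi.add_apply]

lemma iter_R (R : ℝ → (X₀ →L[ℂ] X₀))
    (hRsc : ∀ x : X₀, ContinuousOn (fun t => R t x) (Ici 0))
    (hRfix : ∀ t ∈ Ici (0:ℝ), R t = M.T t + M.Bop L R t) (n : ℕ) :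
    ∀ t, 0 ≤ t → (M.Bop L)^[n] R t = (M.Bop L)^[n] M.T t + (M.Bop L)^[n + 1] R t := by
  induction n with
  | zero => intro t ht; exact hRfix t ht
  | succ n ih =>
    intro t ht
    rw [Function.iterate_succ_apply', Function.iterate_succ_apply' _ n M.T,
      Function.iterate_succ_apply' _ (n + 1)]
    exact M.Bop_add L (M.iter_cont L hRsc n) (M.iter_cont L M.T_cont n)
      (M.iter_cont L hRsc (n + 1)) ih t ht

lemma iter_bound (R : ℝ → (X₀ →L[ℂ] X₀))
    (hRsc : ∀ x : X₀, ContinuousOn (fun t => R t x) (Ici 0))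
    (p : ℝ) (hp : 1 ≤ p) (Mhat ωhat : ℝ) (hMhat : 0 ≤ Mhat)
    (hq : ∀ f : ℝ → X, ContinuousOn f (Ici 0) → ∀ t ∈ Ici (0:ℝ),
      ‖M.SD f t‖ ≤ Mhat * (∫ s in (0:ℝ)..t, Real.exp (p * ωhat * (t - s)) * ‖f s‖ ^ p) ^ (1 / p))
    (τ D c : ℝ) (hD0 : 0 < D) (hD : ∀ t ∈ Icc (0:ℝ) τ, ‖R t‖ ≤ D)
    (hc : c = Mhat ^ p * (Real.exp (p * |ωhat| * τ) * ‖L‖ ^ p)) (x : X₀) (n : ℕ) :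
    ∀ t ∈ Icc (0:ℝ) τ, ‖(M.Bop L)^[n] R t x‖ ^ p ≤
      (D * ‖x‖) ^ p * ((c * t) ^ n / (n.factorial : ℝ)) := by
  have hp0 : 0 < p := by linarith
  have hc0 : 0 ≤ c := by rw [hc]; positivity
  induction n with
  | zero =>
    intro t ht
    simp only [Function.iterate_zero, id_eq, pow_zero, Nat.factorial_zero, Nat.cast_one, div_one,
      mul_one]
    gcongr
    exact (R t).le_of_opNorm_le (hD t ht) x
  | succ n ih =>
    intro t ht
    rw [Function.iterate_succ_apply', M.Bop_apply L (M.iter_cont L hRsc n)]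
    set U := (M.Bop L)^[n] R with hU
    have hUc := M.iter_cont L hRsc n x
    have hLc := LU_cont L (M.iter_cont L hRsc n) x
    have h1 := hq _ hLc t ht.1
    set I := ∫ s in (0:ℝ)..t, Real.exp (p * ωhat * (t - s)) * ‖L (U s x)‖ ^ p with hI
    have hI0 : 0 ≤ I := intervalIntegral.integral_nonneg ht.1 fun u _ => by positivity
    have h2 : ‖M.SD (fun s => L (U s x)) t‖ ^ p ≤ Mhat ^ p * I := by
      calc _ ≤ (Mhat * I ^ (1 / p)) ^ p := by gcongr
        _ = _ := by
          rw [Real.mul_rpow hMhat (by positivity), ← Real.rpow_mul hI0, one_div_mul_cancel hp0.ne',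
            Real.rpow_one]
    set e := Real.exp (p * |ωhat| * τ) with he
    have h3 : I ≤ ∫ s in (0:ℝ)..t, (e * ‖L‖ ^ p * ((D * ‖x‖) ^ p * (c ^ n / (n.factorial : ℝ)))) *
        s ^ n := by
      apply intervalIntegral.integral_mono_on ht.1
      · apply ContinuousOn.intervalIntegrable
        rw [uIcc_of_le ht.1]
        refine ContinuousOn.mul (by fun_prop) ?_
        exact (hLc.mono Icc_subset_Ici_self).norm.rpow_const (fun _ _ => Or.inr hp0.le)
      · apply Continuous.intervalIntegrable; fun_prop
      · intro s hs
        have i1 := ih s ⟨hs.1, hs.2.trans ht.2⟩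
        have i2 : Real.exp (p * ωhat * (t - s)) ≤ e := by
          apply Real.exp_le_exp.2
          have h3 : ωhat * (t - s) ≤ |ωhat| * τ :=
            mul_le_mul (le_abs_self _) (by linarith [hs.1, ht.2]) (by linarith [hs.2]) (abs_nonneg _)
          rw [mul_assoc, mul_assoc]; gcongr
        have i3 : ‖L (U s x)‖ ^ p ≤ ‖L‖ ^ p * ‖U s x‖ ^ p := by
          have h0 := Real.mul_rpow (z := p) (norm_nonneg L) (norm_nonneg (U s x))
          rw [← h0]
          exact Real.rpow_le_rpow (norm_nonneg _) (L.le_opNorm _) hp0.le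
        calc _ ≤ e * (‖L‖ ^ p * ((D * ‖x‖) ^ p * ((c * s) ^ n / (n.factorial : ℝ)))) := by
              gcongr
              exact i3.trans (by gcongr)
          _ = _ := by rw [mul_pow]; ring
    rw [intervalIntegral.integral_const_mul, integral_pow] at h3
    refine h2.trans ((mul_le_mul_of_nonneg_left h3 (by positivity)).trans (le_of_eq ?_))
    rw [Nat.factorial_succ, mul_pow, pow_succ c, zero_pow (by omega), sub_zero]
    push_cast
    have hcc : c ^ n * c = c ^ n * (Mhat ^ p * (e * ‖L‖ ^ p)) := by rw [← hc]
    rw [hcc]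
    field_simp

lemma R_compact (hLT : ∀ t : ℝ, 0 < t → IsCompactOperator ⇑(L.comp (M.T t)))
    (R : ℝ → (X₀ →L[ℂ] X₀))
    (hRsc : ∀ x : X₀, ContinuousOn (fun t => R t x) (Ici 0))
    (hRfix : ∀ t ∈ Ici (0:ℝ), R t = M.T t + M.Bop L R t)
    (p : ℝ) (hp : 1 ≤ p) (Mhat ωhat : ℝ) (hMhat : 0 ≤ Mhat)
    (hq : ∀ f : ℝ → X, ContinuousOn f (Ici 0) → ∀ t ∈ Ici (0:ℝ),
      ‖M.SD f t‖ ≤ Mhat * (∫ s in (0:ℝ)..t, Real.exp (p * ωhat * (t - s)) * ‖f s‖ ^ p) ^ (1 / p))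
    (t : ℝ) (ht : 0 ≤ t) : IsCompactOperator ⇑(R t - M.T t - M.Bop L M.T t) := by
  have := M.complete
  have hp0 : 0 < p := by linarith
  obtain ⟨D, hD0, hD⟩ := locbdd R hRsc t
  set c := Mhat ^ p * (Real.exp (p * |ωhat| * t) * ‖L‖ ^ p) with hc
  have hc0 : 0 ≤ c := by positivity
  have hn : ∀ n, ‖(M.Bop L)^[n] R t‖ ≤ D * ((c * t) ^ n / (n.factorial : ℝ)) ^ (1 / p) := by
    intro n
    refine ContinuousLinearMap.opNorm_le_bound _ (by positivity) fun x => ?_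
    have h1 := M.iter_bound L R hRsc p hp Mhat ωhat hMhat hq t D c hD0 hD hc x n t ⟨ht, le_rfl⟩
    have h2 := Real.rpow_le_rpow (by positivity) h1 (by positivity : 0 ≤ 1 / p)
    rw [← Real.rpow_mul (norm_nonneg _), mul_one_div_cancel hp0.ne', Real.rpow_one,
      Real.mul_rpow (by positivity) (by positivity), ← Real.rpow_mul (by positivity),
      mul_one_div_cancel hp0.ne', Real.rpow_one] at h2
    linarith
  have hlim : Tendsto (fun n => (M.Bop L)^[n] R t) atTop (𝓝 0) := by
    refine tendsto_zero_of_bound (fun n => (M.Bop L)^[n] R t) _ hn ?_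
    have h1 := (FloorSemiring.tendsto_pow_div_factorial_atTop (c * t)).rpow_const
      (p := 1 / p) (Or.inr (by positivity))
    rw [Real.zero_rpow (by positivity)] at h1
    simpa using h1.const_mul D
  have hcomp : ∀ n, IsCompactOperator
      ⇑(R t - M.T t - M.Bop L M.T t - (M.Bop L)^[n + 2] R t) := by
    intro n
    induction n with
    | zero =>
      have h0 := M.iter_R L R hRsc hRfix 0 t ht
      have h1 := M.iter_R L R hRsc hRfix 1 t ht
      have : R t - M.T t - M.Bop L M.T t - (M.Bop L)^[0 + 2] R t = 0 := by
        change R t = M.T t + (M.Bop L)^[1] R t at h0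
        change (M.Bop L)^[1] R t = M.Bop L M.T t + (M.Bop L)^[0 + 2] R t at h1
        rw [h0, h1]; abel
      rw [this]; exact isCompactOperator_zero
    | succ n ih =>
      have h1 := M.iter_R L R hRsc hRfix (n + 2) t ht
      have h2 := M.iter_compact L hLT p hp Mhat ωhat hMhat hq n t ht
      have h3 := ih.add h2
      have e : R t - M.T t - M.Bop L M.T t - (M.Bop L)^[n + 1 + 2] R t =
          (R t - M.T t - M.Bop L M.T t - (M.Bop L)^[n + 2] R t) + (M.Bop L)^[n + 2] M.T t := by
        rw [h1, show n + 1 + 2 = n + 2 + 1 by ring]; abel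
      rw [e]; exact h3
  have hl2 : Tendsto (fun n => R t - M.T t - M.Bop L M.T t - (M.Bop L)^[n + 2] R t) atTop
      (𝓝 (R t - M.T t - M.Bop L M.T t - 0)) :=
    tendsto_const_nhds.sub ((tendsto_add_atTop_iff_nat 2).2 hlim)
  rw [sub_zero] at hl2
  exact isCompactOperator_of_tendsto hl2 (Eventually.of_forall hcomp)

end MRSetting

/-- for a `p`-quasi Hille–Yosida operator, compactness of `L ∘ T₀` on `(0,∞)`
implies equality of the essential growth bounds of `T₀` and of the perturbed semigroup. -/
theorem ess_growth_bound_quasiHY (M : MRSetting X X₀) (L : X₀ →L[ℂ] X)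
    (R : ℝ → (X₀ →L[ℂ] X₀))
    (hRsc : ∀ x : X₀, ContinuousOn (fun t => R t x) (Ici 0))
    (hRfix : ∀ t ∈ Ici (0:ℝ), R t = M.T t + M.Bop L R t)
    (p : ℝ) (hp : 1 ≤ p) (Mhat ωhat : ℝ) (hMhat : 0 ≤ Mhat)
    (hq : ∀ f : ℝ → X, ContinuousOn f (Ici 0) → ∀ t ∈ Ici (0:ℝ),
      ‖M.SD f t‖ ≤ Mhat * (∫ s in (0:ℝ)..t, Real.exp (p * ωhat * (t - s)) * ‖f s‖ ^ p) ^ (1 / p))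
    (hLT : ∀ t : ℝ, 0 < t → IsCompactOperator ⇑(L.comp (M.T t))) :
    omegaEss R = omegaEss M.T := by
  have := M.complete
  set Q := M.Bop L M.T with hQdef
  have hQb : ∀ τ, ∃ C, 0 < C ∧ ∀ t ∈ Icc (0:ℝ) τ, ‖Q t‖ ≤ C :=
    fun τ => locbdd Q (M.Bop_cont L M.T_cont) τ
  have hK : ∀ t, 0 ≤ t → IsCompactOperator ⇑(R t - M.T t - Q t) := fun t ht =>
    M.R_compact L hLT R hRsc hRfix p hp Mhat ωhat hMhat hq t ht
  have hS2 : ∀ t, 0 ≤ t → IsCompactOperator ⇑(M.Bop L Q t) := fun t ht =>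
    M.iter_compact L hLT p hp Mhat ωhat hMhat hq 0 t ht
  have hadd : ∀ t s, 0 ≤ t → 0 ≤ s → Q (t + s) = (M.T s).comp (Q t) + (Q s).comp (M.T t) := by
    intro t s ht hs
    ext1 x
    exact M.S1_add L t s ht hs x
  have hQQ : ∀ t s, 0 ≤ t → 0 ≤ s → IsCompactOperator ⇑((Q s).comp (Q t)) := by
    intro t s ht hs
    have e : (Q s).comp (Q t) = M.Bop L Q (t + s) - ((M.T s).comp (M.Bop L Q t) +
        (M.Bop L Q s).comp (M.T t)) := by
      ext1 x
      have := M.S2_add L t s ht hs x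
      simp only [sub_apply, ContinuousLinearMap.comp_apply,
        add_apply]
      rw [this]; abel
    rw [e]
    exact (hS2 _ (by positivity)).sub (((hS2 t ht).clm_comp (M.T s)).add
      ((hS2 s hs).comp_clm (M.T t)))
  have hrelT : ∀ t s, 0 ≤ t → 0 ≤ s →
      IsCompactOperator ⇑(Q (t + s) - ((M.T s).comp (Q t) + (Q s).comp (M.T t))) := by
    intro t s ht hs
    rw [hadd t s ht hs, sub_self]; exact isCompactOperator_zero
  have hrelR : ∀ t s, 0 ≤ t → 0 ≤ s →
      IsCompactOperator ⇑(Q (t + s) - ((R s).comp (Q t) + (Q s).comp (R t))) := by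
    intro t s ht hs
    have e : Q (t + s) - ((R s).comp (Q t) + (Q s).comp (R t)) =
        -((((Q s).comp (Q t) + (Q s).comp (Q t)) + (R s - M.T s - Q s).comp (Q t)) +
          (Q s).comp (R t - M.T t - Q t)) := by
      rw [hadd t s ht hs]
      ext1 x
      simp only [sub_apply, ContinuousLinearMap.comp_apply,
        add_apply, neg_apply, map_sub]
      abel
    rw [e]
    exact ((((hQQ t s ht hs).add (hQQ t s ht hs)).add ((hK s hs).comp_clm (Q t))).add
      ((hK t ht).clm_comp (Q s))).neg
  apply le_antisymm
  · refine omegaEss_le fun w w' C hw hC hT => ?_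
    obtain ⟨C', hC', h'⟩ := growth Q M.T hrelT hQb w w' C hw hC hT
    refine ⟨C + C', by positivity, fun t ht => ?_⟩
    have h1 := qess_cong (R t) (M.T t + Q t) (by rw [← sub_sub]; exact hK t ht)
    have h2 := qess_add (M.T t) (Q t)
    have h3 := hT t ht
    have h4 := h' t ht
    have h5 : C * Real.exp (w * t) ≤ C * Real.exp (w' * t) := by gcongr
    linarith
  · refine omegaEss_le fun w w' C hw hC hT => ?_
    obtain ⟨C', hC', h'⟩ := growth Q R hrelR hQb w w' C hw hC hT
    refine ⟨C + C', by positivity, fun t ht => ?_⟩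
    have h1 := qess_cong (M.T t) (R t + -Q t) (by
      have e : M.T t - (R t + -Q t) = -(R t - M.T t - Q t) := by abel
      rw [e]; exact (hK t ht).neg)
    have h2 := qess_add (R t) (-Q t)
    have h2' := qess_neg (Q t)
    have h3 := hT t ht
    have h4 := h' t ht
    have h5 : C * Real.exp (w * t) ≤ C * Real.exp (w' * t) := by gcongr
    linarith

end
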